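/- arXiv:1409.7383 — 4 statements merged into one kernel-verified Lean document; each statement's English description precedes it below -/
import Mathlib

section
/- Let $-1<\beta<0$ and $\tilde t>0$, and let $v\in \mathcal C^1([0,\tilde t])$. Then $\int_0^{\tilde t} v(t)\,\mathcal B_{\beta} v(t)\,dt \ge 0$, where $\mathcal B_{\beta} v(t)=\frac{d}{dt}\int_0^t \omega_{\beta+1}(t-s)\,v(s)\,ds$. -/
open Real intervalIntegral Set

open MeasureTheory

/-- The extension of a function on `[0, T]` to the real line by its boundary values. -/
def constExtend (T : ℝ) (u : ℝ → ℝ) (x : ℝ) : ℝ := u (max 0 (min x T))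

lemma max_zero_min_mem_Icc {T : ℝ} (hT : 0 ≤ T) (x : ℝ) : max 0 (min x T) ∈ Icc 0 T :=
  ⟨le_max_left _ _, max_le hT (min_le_right _ _)⟩

lemma constExtend_of_mem {T x : ℝ} (u : ℝ → ℝ) (hx : x ∈ Icc 0 T) : constExtend T u x = u x := by
  rw [constExtend, min_eq_left hx.2, max_eq_right hx.1]

lemma constExtend_of_nonpos {T x : ℝ} (u : ℝ → ℝ) (hx : x ≤ 0) : constExtend T u x = u 0 := by
  rw [constExtend, max_eq_left ((min_le_left _ _).trans hx)]

lemma continuous_constExtend {T : ℝ} (hT : 0 ≤ T) {u : ℝ → ℝ} (hu : ContinuousOn u (Icc 0 T)) :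
    Continuous (constExtend T u) :=
  hu.comp_continuous (by fun_prop) (max_zero_min_mem_Icc hT)

lemma exists_abs_le_of_continuousOn_Icc {T : ℝ} {u : ℝ → ℝ} (hu : ContinuousOn u (Icc 0 T)) :
    ∃ C, 0 ≤ C ∧ ∀ x ∈ Icc 0 T, |u x| ≤ C := by
  obtain ⟨C, hC⟩ := isCompact_Icc.exists_bound_of_continuousOn hu
  exact ⟨max C 0, le_max_right _ _, fun x hx => (hC x hx).trans (le_max_left _ _)⟩

/-- A `C¹` function on `[0, T]` is Lipschitz there. -/
lemma exists_abs_sub_le_of_hasDerivAt {T : ℝ} {u u' : ℝ → ℝ}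
    (hu : ∀ s ∈ Icc (0 : ℝ) T, HasDerivAt u (u' s) s) (hu' : ContinuousOn u' (Icc 0 T)) :
    ∃ C, 0 ≤ C ∧ ∀ x ∈ Icc 0 T, ∀ y ∈ Icc 0 T, |u x - u y| ≤ C * |x - y| := by
  obtain ⟨C, hC, h⟩ := exists_abs_le_of_continuousOn_Icc hu'
  exact ⟨C, hC, fun x hx y hy => (convex_Icc 0 T).norm_image_sub_le_of_norm_hasDerivWithin_le
    (fun s hs => (hu s hs).hasDerivWithinAt) h hy hx⟩

/-- A truncated convolution on `[0, x]` in terms of a convolution over the fixed interval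
`[0, T]`. -/
lemma convolution_eq_constExtend {T x : ℝ} {κ u : ℝ → ℝ} (hκ : IntervalIntegrable κ volume 0 T)
    (hu : ContinuousOn u (Icc 0 T)) (hx : x ∈ Icc 0 T) :
    ∫ s in (0 : ℝ)..x, κ (x - s) * u s =
      (∫ τ in (0 : ℝ)..T, κ τ * constExtend T u (x - τ)) - (∫ τ in x..T, κ τ) * u 0 := by
  have hT : 0 ≤ T := hx.1.trans hx.2
  have hcont := continuous_constExtend hT hu
  have hint : IntervalIntegrable (fun τ => κ τ * constExtend T u (x - τ)) volume 0 T :=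
    hκ.mul_continuousOn (by fun_prop)
  have hxT : x ∈ uIcc 0 T := by rwa [uIcc_of_le hT]
  have h0 : (0 : ℝ) ∈ uIcc 0 T := left_mem_uIcc
  have h1 : T ∈ uIcc 0 T := right_mem_uIcc
  rw [← integral_add_adjacent_intervals (hint.mono_set (uIcc_subset_uIcc h0 hxT))
    (hint.mono_set (uIcc_subset_uIcc hxT h1))]
  have e1 : ∫ s in (0 : ℝ)..x, κ (x - s) * u s =
      ∫ τ in (0 : ℝ)..x, κ τ * constExtend T u (x - τ) := by
    have := intervalIntegral.integral_comp_sub_left (a := 0) (b := x)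
      (fun τ => κ τ * u (x - τ)) x
    simp only [sub_sub_cancel, sub_self, sub_zero] at this
    rw [this]
    refine integral_congr fun τ hτ => ?_
    rw [uIcc_of_le hx.1] at hτ
    have : x - τ ∈ Icc 0 T := ⟨by linarith [hτ.2], by linarith [hτ.1, hx.2]⟩
    simp only [constExtend_of_mem u this]
  have e2 : ∫ τ in x..T, κ τ * constExtend T u (x - τ) = (∫ τ in x..T, κ τ) * u 0 := by
    rw [← intervalIntegral.integral_mul_const ]
    refine integral_congr fun τ hτ => ?_
    rw [uIcc_of_le hx.2] at hτ
    simp only [constExtend_of_nonpos u (show x - τ ≤ 0 by linarith [hτ.1])]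
  rw [e1, e2]
  ring

lemma continuousOn_convolution {T : ℝ} {κ u : ℝ → ℝ} (hT : 0 ≤ T)
    (hκ : IntervalIntegrable κ volume 0 T) (hu : ContinuousOn u (Icc 0 T)) :
    ContinuousOn (fun x => ∫ s in (0 : ℝ)..x, κ (x - s) * u s) (Icc 0 T) := by
  refine ContinuousOn.congr ?_ fun x hx => convolution_eq_constExtend hκ hu hx
  obtain ⟨C, hC, hb⟩ := exists_abs_le_of_continuousOn_Icc hu
  have hcont := continuous_constExtend hT hu
  refine ContinuousOn.sub (Continuous.continuousOn ?_) (ContinuousOn.mul ?_ continuousOn_const)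
  · refine intervalIntegral.continuous_of_dominated_interval (bound := fun τ => |κ τ| * C) ?_ ?_
      (hκ.abs.mul_const C) ?_
    · intro x
      exact (hκ.mul_continuousOn (by fun_prop :
        ContinuousOn (fun τ => constExtend T u (x - τ)) _)).def'.aestronglyMeasurable
    · refine fun x => Filter.Eventually.of_forall fun τ _ => ?_
      rw [norm_mul]
      exact mul_le_mul_of_nonneg_left (hb _ (max_zero_min_mem_Icc hT _)) (abs_nonneg _)
    · exact Filter.Eventually.of_forall fun τ _ => by fun_prop
  · have := continuousOn_primitive_interval_left
      (f := κ) (μ := volume) (a := 0) (b := T)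
      (by rw [uIcc_of_le hT]; exact (intervalIntegrable_iff_integrableOn_Icc_of_le hT).1 hκ)
    rwa [uIcc_of_le hT] at this

lemma hasDerivAt_convolution {T t : ℝ} {κ u u' : ℝ → ℝ}
    (hκ : IntervalIntegrable κ volume 0 T) (ht : t ∈ Ioo 0 T) (hκt : ContinuousAt κ t)
    (hu : ∀ s ∈ Icc (0 : ℝ) T, HasDerivAt u (u' s) s) (hu' : ContinuousOn u' (Icc 0 T)) :
    HasDerivAt (fun x => ∫ s in (0 : ℝ)..x, κ (x - s) * u s)
      (κ t * u 0 + ∫ τ in (0 : ℝ)..t, κ τ * u' (t - τ)) t := by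
  have hT : 0 ≤ T := (ht.1.trans ht.2).le
  have huc : ContinuousOn u (Icc 0 T) := fun s hs => (hu s hs).continuousAt.continuousWithinAt
  have hcont := continuous_constExtend hT huc
  have hcont' := continuous_constExtend hT hu'
  obtain ⟨C, hC, hlip⟩ := exists_abs_sub_le_of_hasDerivAt hu hu'
  have hmeas : ∀ x, IntervalIntegrable (fun τ => κ τ * constExtend T u (x - τ)) volume 0 T :=
    fun x => hκ.mul_continuousOn (by fun_prop)
  have key := intervalIntegral.hasDerivAt_integral_of_dominated_loc_of_lip (μ := volume) (a := 0) (b := T)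
    (F := fun x τ => κ τ * constExtend T u (x - τ)) (x₀ := t) (s := univ)
    (F' := fun τ => κ τ * (Iio t).indicator (fun τ => constExtend T u' (t - τ)) τ)
    (bound := fun τ => κ τ * C) Filter.univ_mem
    (Filter.Eventually.of_forall fun x => (hmeas x).def'.aestronglyMeasurable) (hmeas t)
    (hκ.def'.aestronglyMeasurable.mul
      ((by fun_prop : Continuous fun τ => constExtend T u' (t - τ)).aestronglyMeasurable.indicator
        measurableSet_Iio)) ?_ (hκ.mul_const C) ?_
  · have hder := key.2.sub (((integral_hasDerivAt_left (a := t) (b := T) (f := κ)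
      (hκ.mono_set (uIcc_subset_uIcc (by rw [uIcc_of_le hT]; exact ⟨ht.1.le, ht.2.le⟩)
        right_mem_uIcc))
      ⟨_, Ioc_mem_nhds ht.1 ht.2, hκ.1.1⟩ hκt)).mul_const (u 0))
    have hev : (fun x => ∫ s in (0 : ℝ)..x, κ (x - s) * u s) =ᶠ[nhds t] fun x =>
        (∫ τ in (0 : ℝ)..T, κ τ * constExtend T u (x - τ)) - (∫ τ in x..T, κ τ) * u 0 := by
      filter_upwards [Icc_mem_nhds ht.1 ht.2] with x hx
      exact convolution_eq_constExtend hκ huc hx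
    refine (hder.congr_of_eventuallyEq hev).congr_deriv ?_
    have htT : t ∈ uIcc 0 T := by rw [uIcc_of_le hT]; exact ⟨ht.1.le, ht.2.le⟩
    rw [← integral_add_adjacent_intervals
      (key.1.mono_set (uIcc_subset_uIcc left_mem_uIcc htT))
      (key.1.mono_set (uIcc_subset_uIcc htT right_mem_uIcc))]
    have e1 : ∫ τ in t..T, κ τ * (Iio t).indicator (fun τ => constExtend T u' (t - τ)) τ = 0 := by
      refine (integral_congr (g := fun _ => 0) fun τ hτ => ?_).trans (by simp)
      rw [uIcc_of_le ht.2.le] at hτ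
      simp [indicator_of_notMem, hτ.1]
    have e2 : ∫ τ in (0 : ℝ)..t, κ τ * (Iio t).indicator (fun τ => constExtend T u' (t - τ)) τ =
        ∫ τ in (0 : ℝ)..t, κ τ * u' (t - τ) := by
      refine integral_congr_ae ?_
      filter_upwards [Measure.ae_ne volume t] with τ hne hτ
      rw [uIoc_of_le ht.1.le] at hτ
      rw [indicator_of_mem (show τ ∈ Iio t from lt_of_le_of_ne hτ.2 hne),
        constExtend_of_mem u' ⟨by linarith [hτ.2], by linarith [hτ.1, ht.2]⟩]
    rw [e1, e2]
    ring
  · refine Filter.Eventually.of_forall fun τ _ => LipschitzOnWith.of_dist_le_mul fun x _ y _ => ?_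
    rw [dist_eq_norm, dist_eq_norm, ← mul_sub, norm_mul, coe_nnabs, abs_mul, abs_of_nonneg hC,
      mul_assoc]
    refine mul_le_mul_of_nonneg_left ?_ (abs_nonneg _)
    refine (hlip _ (max_zero_min_mem_Icc hT _) _ (max_zero_min_mem_Icc hT _)).trans
      (mul_le_mul_of_nonneg_left ?_ hC)
    rw [max_comm 0, max_comm 0]
    refine (abs_max_sub_max_le_abs _ _ _).trans ((abs_min_sub_min_le_max _ _ _ _).trans ?_)
    simp
  · filter_upwards [Measure.ae_ne volume t] with τ hne hτ
    rw [uIoc_of_le hT] at hτ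
    refine HasDerivAt.const_mul _ ?_
    rcases lt_or_gt_of_ne hne with h | h
    · rw [indicator_of_mem (show τ ∈ Iio t from h),
        constExtend_of_mem u' ⟨by linarith, by linarith [hτ.1, ht.2]⟩]
      have := (hu (t - τ) ⟨by linarith, by linarith [hτ.1, ht.2]⟩).comp_sub_const t τ
      refine this.congr_of_eventuallyEq ?_
      filter_upwards [Ioo_mem_nhds h ht.2] with x hx
      exact constExtend_of_mem u ⟨by linarith [hx.1], by linarith [hx.2, hτ.1]⟩
    · rw [indicator_of_notMem (by simpa using h.le)]
      refine (hasDerivAt_const t (u 0)).congr_of_eventuallyEq ?_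
      filter_upwards [Iio_mem_nhds h] with x hx
      exact constExtend_of_nonpos u (by linarith [mem_Iio.1 hx])

/-- Integration by parts against a decreasing power kernel produces a nonnegative bulk term. -/
lemma rpow_mul_sq_le_integral {β c t : ℝ} (hβ₁ : -1 < β) (hβ₂ : β < 0) (hc : 0 ≤ c) (ht : 0 < t)
    {v v' : ℝ → ℝ} (hv : ∀ s ∈ Icc (0 : ℝ) t, HasDerivAt v (v' s) s)
    (hv' : ContinuousOn v' (Icc 0 t)) :
    1 / 2 * (t ^ β / c * (v t - v 0) ^ 2) ≤
      ∫ τ in (0 : ℝ)..t, τ ^ β / c * ((v t - v (t - τ)) * v' (t - τ)) := by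
  have hvc : ContinuousOn v (Icc 0 t) := fun s hs => (hv s hs).continuousAt.continuousWithinAt
  have hmaps : MapsTo (fun τ => t - τ) (Icc 0 t) (Icc 0 t) :=
    fun τ hτ => ⟨by linarith [hτ.2], by linarith [hτ.1]⟩
  have hsub : ContinuousOn (fun τ => t - τ) (Icc 0 t) := by fun_prop
  have hD : ContinuousOn (fun τ => v t - v (t - τ)) (Icc 0 t) :=
    continuousOn_const.sub (hvc.comp hsub hmaps)
  have hD' : ContinuousOn (fun τ => v' (t - τ)) (Icc 0 t) := hv'.comp hsub hmaps
  obtain ⟨C, hC, hlip⟩ := exists_abs_sub_le_of_hasDerivAt hv hv'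
  have hint : IntegrableOn (fun τ => τ ^ β / c * ((v t - v (t - τ)) * v' (t - τ))) (Icc 0 t) := by
    rw [← intervalIntegrable_iff_integrableOn_Icc_of_le ht.le]
    refine ((intervalIntegrable_rpow' hβ₁).div_const c).mul_continuousOn ?_
    rw [uIcc_of_le ht.le]
    exact hD.mul hD'
  have key := sub_le_integral_of_hasDeriv_right_of_le
    (g := fun τ => 1 / 2 * (τ ^ β / c * (v t - v (t - τ)) ^ 2))
    (g' := fun τ => 1 / 2 * (β * τ ^ (β - 1) / c * (v t - v (t - τ)) ^ 2 +
      τ ^ β / c * (2 * (v t - v (t - τ)) * v' (t - τ)))) ht.le ?_ ?_ hint ?_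
  · simpa using key
  · intro τ hτ
    rcases hτ.1.eq_or_lt with rfl | hpos
    · have hlim : Filter.Tendsto (fun τ : ℝ => 1 / 2 * (τ ^ (β + 1) / c * (C * (C * τ))))
          (nhdsWithin 0 (Icc 0 t)) (nhds 0) := by
        have : ContinuousAt (fun τ : ℝ => 1 / 2 * (τ ^ (β + 1) / c * (C * (C * τ)))) 0 := by
          have : ContinuousAt (fun τ : ℝ => τ ^ (β + 1)) 0 :=
            continuousAt_rpow_const _ _ (Or.inr (by linarith))
          fun_prop
        simpa [ContinuousAt] using this.tendsto.mono_left nhdsWithin_le_nhds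
      rw [ContinuousWithinAt]
      have h0 : (1 / 2 * ((0 : ℝ) ^ β / c * (v t - v (t - 0)) ^ 2)) = 0 := by simp
      rw [h0]
      refine squeeze_zero_norm' ?_ hlim
      filter_upwards [self_mem_nhdsWithin] with τ hτ
      have hb := hlip t ⟨ht.le, le_rfl⟩ (t - τ) (hmaps hτ)
      rw [sub_sub_cancel, abs_of_nonneg hτ.1] at hb
      rcases hτ.1.eq_or_lt with rfl | hpos
      · simp
      have hk : 0 ≤ τ ^ β / c := div_nonneg (rpow_nonneg hτ.1 _) hc
      have hsq : (v t - v (t - τ)) ^ 2 ≤ (C * τ) ^ 2 := by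
        rw [← sq_abs]
        gcongr
      rw [norm_of_nonneg (by positivity), rpow_add_one hpos.ne']
      calc 1 / 2 * (τ ^ β / c * (v t - v (t - τ)) ^ 2)
          ≤ 1 / 2 * (τ ^ β / c * (C * τ) ^ 2) := by gcongr
        _ = _ := by ring
    · have : ContinuousWithinAt (fun τ : ℝ => τ ^ β) (Icc 0 t) τ :=
        (continuousAt_rpow_const _ _ (Or.inl hpos.ne')).continuousWithinAt
      exact continuousWithinAt_const.mul ((this.div_const c).mul ((hD τ hτ).pow 2))
  · intro τ hτ
    have h1 := (hasDerivAt_rpow_const (p := β) (Or.inl hτ.1.ne')).div_const c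
    have h2 : HasDerivAt (fun τ => v t - v (t - τ)) (v' (t - τ)) τ := by
      simpa using ((hv _ (hmaps ⟨hτ.1.le, hτ.2.le⟩)).comp_const_sub t τ).const_sub (v t)
    refine (((h1.mul (h2.pow 2)).const_mul (1 / 2)).congr_deriv ?_).hasDerivWithinAt
    simp
  · intro τ hτ
    have : β * τ ^ (β - 1) / c * (v t - v (t - τ)) ^ 2 ≤ 0 :=
      mul_nonpos_of_nonpos_of_nonneg (div_nonpos_of_nonpos_of_nonneg
        (mul_nonpos_of_nonpos_of_nonneg hβ₂.le (rpow_nonneg hτ.1.le _)) hc) (sq_nonneg _)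
    linarith

/-- Positivity of the fractional derivative quadratic form: for `-1 < β < 0`, `t̃ > 0`
and `v ∈ C¹([0,t̃])`, `∫₀^{t̃} v(t) 𝓑_β v(t) dt ≥ 0`, where
`𝓑_β v(t) = d/dt ∫₀ᵗ ω_{β+1}(t-s) v(s) ds`. -/
theorem stmt_6 (β ttilde : ℝ) (hβ₁ : -1 < β) (hβ₂ : β < 0) (ht : 0 < ttilde)
    (v v' : ℝ → ℝ)
    (hv : ∀ s ∈ Set.Icc (0:ℝ) ttilde, HasDerivAt v (v' s) s)
    (hv' : ContinuousOn v' (Set.Icc 0 ttilde)) :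
    0 ≤ ∫ t in (0:ℝ)..ttilde,
          v t * deriv (fun τ => ∫ s in (0:ℝ)..τ, ((τ - s) ^ β / Real.Gamma (β + 1)) * v s) t := by
  set c := Real.Gamma (β + 1) with hc_def
  have hc : 0 ≤ c := (Real.Gamma_pos_of_pos (by linarith)).le
  let κ : ℝ → ℝ := fun τ => τ ^ β / c
  have hκ : ∀ a b, IntervalIntegrable κ volume a b :=
    fun a b => (intervalIntegrable_rpow' hβ₁).div_const c
  have hκt : ∀ t, 0 < t → ContinuousAt κ t :=
    fun t h => (continuousAt_rpow_const _ _ (Or.inl h.ne')).div_const c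
  have hvc : ContinuousOn v (Icc 0 ttilde) :=
    fun s hs => (hv s hs).continuousAt.continuousWithinAt
  have hsq : ∀ s ∈ Icc (0 : ℝ) ttilde, HasDerivAt (fun s => v s ^ 2) (2 * v s * v' s) s :=
    fun s hs => ((hv s hs).pow 2).congr_deriv (by simp)
  by_cases hint : IntervalIntegrable (fun t => v t *
      deriv (fun τ => ∫ s in (0 : ℝ)..τ, κ (τ - s) * v s) t) volume 0 ttilde
  swap
  · exact (integral_undef hint).ge
  have key := sub_le_integral_of_hasDeriv_right_of_le
    (g := fun x => 1 / 2 * ∫ s in (0 : ℝ)..x, κ (x - s) * v s ^ 2)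
    (g' := fun t => 1 / 2 * (κ t * v 0 ^ 2 +
      ∫ τ in (0 : ℝ)..t, κ τ * (2 * v (t - τ) * v' (t - τ)))) ht.le
    (continuousOn_const.mul (continuousOn_convolution ht.le (hκ _ _) (hvc.pow 2)))
    (fun t h => ((hasDerivAt_convolution (hκ _ _) h (hκt t h.1) hsq
      ((continuousOn_const.mul hvc).mul hv')).const_mul _).hasDerivWithinAt)
    ((intervalIntegrable_iff_integrableOn_Icc_of_le ht.le).1 hint) ?_
  · refine le_trans ?_ key
    simp only [integral_same, mul_zero, sub_zero]
    refine mul_nonneg (by norm_num) (integral_nonneg ht.le fun s hs => ?_)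
    exact mul_nonneg (div_nonneg (rpow_nonneg (by linarith [hs.2]) _) hc) (sq_nonneg _)
  · intro t h
    have hIcc : Icc 0 t ⊆ Icc 0 ttilde := Icc_subset_Icc_right h.2.le
    have hmaps : MapsTo (fun τ => t - τ) (uIcc 0 t) (Icc 0 ttilde) := by
      rw [uIcc_of_le h.1.le]
      exact fun τ hτ => hIcc ⟨by linarith [hτ.2], by linarith [hτ.1]⟩
    have hsub : ContinuousOn (fun τ => t - τ) (uIcc 0 t) := by fun_prop
    have hpos := rpow_mul_sq_le_integral hβ₁ hβ₂ hc h.1 (fun s hs => hv s (hIcc hs))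
      (hv'.mono hIcc)
    have i1 : IntervalIntegrable (fun τ => κ τ * v' (t - τ)) volume 0 t :=
      (hκ 0 t).mul_continuousOn (hv'.comp hsub hmaps)
    have i2 : IntervalIntegrable (fun τ => κ τ * (2 * v (t - τ) * v' (t - τ))) volume 0 t :=
      (hκ 0 t).mul_continuousOn
        ((continuousOn_const.mul (hvc.comp hsub hmaps)).mul (hv'.comp hsub hmaps))
    have hsplit : ∫ τ in (0 : ℝ)..t, τ ^ β / c * ((v t - v (t - τ)) * v' (t - τ)) =
        v t * (∫ τ in (0 : ℝ)..t, κ τ * v' (t - τ)) -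
          1 / 2 * ∫ τ in (0 : ℝ)..t, κ τ * (2 * v (t - τ) * v' (t - τ)) := by
      rw [← intervalIntegral.integral_const_mul , ← intervalIntegral.integral_const_mul ,
        ← intervalIntegral.integral_sub (i1.const_mul _) (i2.const_mul _)]
      exact integral_congr fun τ _ => by simp only [κ]; ring
    have hk : 0 ≤ κ t := div_nonneg (rpow_nonneg h.1.le _) hc
    have hsq_t := mul_nonneg hk (sq_nonneg (v t))
    rw [hsplit] at hpos
    change 1 / 2 * (κ t * (v t - v 0) ^ 2) ≤ _ at hpos
    rw [(hasDerivAt_convolution (hκ _ _) h (hκt t h.1) hv hv').deriv]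
    linarith
end

section
/- (Coercivity.) Let $-1<\alpha<0$, $T>0$, and set $c_\alpha = \frac{\cos(\alpha\pi/2)}{\pi^{\alpha}}\cdot\frac{|\alpha|^{-\alpha}}{(1-\alpha)^{1-\alpha}}$. Then for every $v\in \mathcal C^1([0,T])$, $\int_0^T v(t)\,\mathcal B_\alpha v(t)\,dt \;\ge\; c_\alpha\, T^{\alpha} \int_0^T v(t)^2\,dt$. -/
open Real intervalIntegral Set

open MeasureTheory Topology Filter
open scoped Interval

section ParametricIntegral

variable {α : ℝ}

lemma intervalIntegrable_rpow_mul (hα : -1 < α) {f : ℝ → ℝ} (hf : Continuous f) (a b : ℝ) :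
    IntervalIntegrable (fun x => x ^ α * f x) volume a b :=
  (intervalIntegrable_rpow' hα).mul_continuousOn hf.continuousOn

lemma exists_bound_rpow_mul {g : ℝ → ℝ → ℝ} (hg : Continuous (Function.uncurry g)) (t : ℝ) :
    ∃ C, ∀ x ∈ Ι (0 : ℝ) 1, ∀ s ∈ Metric.closedBall t 1, ‖x ^ α * g s x‖ ≤ x ^ α * C := by
  obtain ⟨C, hC⟩ := ((isCompact_closedBall t 1).prod (isCompact_Icc (a := (0 : ℝ)) (b := 1)))
    |>.exists_bound_of_continuousOn hg.continuousOn
  refine ⟨C, fun x hx s hs => ?_⟩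
  rw [uIoc_of_le zero_le_one] at hx
  have hxα : 0 ≤ x ^ α := rpow_nonneg hx.1.le α
  rw [norm_mul, norm_of_nonneg hxα]
  exact mul_le_mul_of_nonneg_left (hC (s, x) ⟨hs, hx.1.le, hx.2⟩) hxα

lemma continuous_integral_rpow_mul (hα : -1 < α) {g : ℝ → ℝ → ℝ}
    (hg : Continuous (Function.uncurry g)) :
    Continuous fun t => ∫ x in (0 : ℝ)..1, x ^ α * g t x := by
  refine continuous_iff_continuousAt.2 fun t => ?_
  obtain ⟨C, hC⟩ := exists_bound_rpow_mul (α := α) hg t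
  refine continuousAt_of_dominated_interval (bound := fun x => x ^ α * C) ?_ ?_
    ((intervalIntegrable_rpow' hα).mul_const C) ?_
  · exact .of_forall fun s =>
      (intervalIntegrable_rpow_mul hα (hg.uncurry_left s) 0 1).def'.aestronglyMeasurable
  · filter_upwards [Metric.closedBall_mem_nhds t one_pos] with s hs
    exact .of_forall fun x hx => hC x hx s hs
  · exact .of_forall fun x _ => ((hg.uncurry_right x).const_mul (x ^ α)).continuousAt

lemma hasDerivAt_integral_rpow_mul (hα : -1 < α) {g g' : ℝ → ℝ → ℝ}
    (hg : Continuous (Function.uncurry g)) (hg' : Continuous (Function.uncurry g'))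
    (h : ∀ t x, HasDerivAt (fun s => g s x) (g' t x) t) (t : ℝ) :
    HasDerivAt (fun s => ∫ x in (0 : ℝ)..1, x ^ α * g s x)
      (∫ x in (0 : ℝ)..1, x ^ α * g' t x) t := by
  obtain ⟨C, hC⟩ := exists_bound_rpow_mul (α := α) hg' t
  refine (hasDerivAt_integral_of_dominated_loc_of_deriv_le (μ := volume)
    (F := fun s x => x ^ α * g s x) (F' := fun s x => x ^ α * g' s x) (bound := fun x => x ^ α * C)
    (Metric.closedBall_mem_nhds t one_pos) ?_ ?_ ?_ ?_
    ((intervalIntegrable_rpow' hα).mul_const C) ?_).2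
  · exact .of_forall fun s =>
      (intervalIntegrable_rpow_mul hα (hg.uncurry_left s) 0 1).def'.aestronglyMeasurable
  · exact intervalIntegrable_rpow_mul hα (hg.uncurry_left t) 0 1
  · exact (intervalIntegrable_rpow_mul hα (hg'.uncurry_left t) 0 1).def'.aestronglyMeasurable
  · exact .of_forall hC
  · exact .of_forall fun x _ s _ => (h s x).const_mul (x ^ α)

end ParametricIntegral

section FractionalDerivative

variable {α : ℝ}

/-- The convolution `∫₀ᵗ (t - s)^α f(s) ds`, rescaled to the unit interval. -/
lemma integral_sub_rpow_mul (hα : α + 1 ≠ 0) (f : ℝ → ℝ) {t : ℝ} (ht : 0 ≤ t) :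
    ∫ s in (0 : ℝ)..t, (t - s) ^ α * f s
      = t ^ (α + 1) * ∫ x in (0 : ℝ)..1, x ^ α * f (t - t * x) := by
  rcases ht.eq_or_lt with rfl | ht
  · simp [zero_rpow hα]
  have h := smul_integral_comp_sub_mul (a := 0) (b := 1) (fun s => (t - s) ^ α * f s) t t
  simp only [mul_one, sub_self, mul_zero, sub_zero] at h
  rw [← h, rpow_add_one ht.ne', smul_eq_mul, mul_comm (t ^ α), mul_assoc,
    ← intervalIntegral.integral_const_mul (t ^ α)]
  congr 1
  refine intervalIntegral.integral_congr fun x hx => ?_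
  rw [uIcc_of_le zero_le_one] at hx
  simp only [sub_sub_cancel]
  rw [mul_rpow ht.le hx.1, mul_assoc]

/-- For `f' = deriv f`, the derivative of `∫₀ᵗ (t - s)^α f(s) ds`, divided by `t ^ α`. -/
noncomputable def scaledFracDeriv (α : ℝ) (f f' : ℝ → ℝ) (t : ℝ) : ℝ :=
  ∫ x in (0 : ℝ)..1, x ^ α * ((α + 1) * f (t - t * x) + t * ((1 - x) * f' (t - t * x)))

lemma continuous_scaledFracDeriv (hα : -1 < α) {f f' : ℝ → ℝ} (hf : Continuous f)
    (hf' : Continuous f') : Continuous (scaledFracDeriv α f f') :=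
  continuous_integral_rpow_mul hα
    (g := fun t x => (α + 1) * f (t - t * x) + t * ((1 - x) * f' (t - t * x)))
    (by simp only [Function.uncurry_def]; fun_prop)

lemma hasDerivAt_rpow_mul_integral (hα : -1 < α) {f f' : ℝ → ℝ}
    (hf : ∀ s, HasDerivAt f (f' s) s) (hf' : Continuous f') {t : ℝ} (ht : 0 < t) :
    HasDerivAt (fun τ => τ ^ (α + 1) * ∫ x in (0 : ℝ)..1, x ^ α * f (τ - τ * x))
      (t ^ α * scaledFracDeriv α f f' t) t := by
  have hfc : Continuous f := continuous_iff_continuousAt.2 fun s => (hf s).continuousAt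
  have h := hasDerivAt_integral_rpow_mul hα (g := fun t x => f (t - t * x))
    (g' := fun t x => (1 - x) * f' (t - t * x))
    (by simp only [Function.uncurry_def]; fun_prop)
    (by simp only [Function.uncurry_def]; fun_prop)
    (fun s x => by
      have := (hf (s - s * x)).comp s ((hasDerivAt_id s).sub ((hasDerivAt_id s).mul_const x))
      exact this.congr_deriv (by simp [mul_comm])) t
  have hp : HasDerivAt (fun τ : ℝ => τ ^ (α + 1)) ((α + 1) * t ^ α) t := by
    simpa using Real.hasDerivAt_rpow_const (x := t) (p := α + 1) (.inl ht.ne')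
  refine (hp.mul h).congr_deriv ?_
  rw [scaledFracDeriv]
  have e : ∀ x : ℝ, x ^ α * ((α + 1) * f (t - t * x) + t * ((1 - x) * f' (t - t * x)))
      = (α + 1) * (x ^ α * f (t - t * x)) + t * (x ^ α * ((1 - x) * f' (t - t * x))) := by
    intro x; ring
  simp only [e]
  rw [intervalIntegral.integral_add, intervalIntegral.integral_const_mul,
    intervalIntegral.integral_const_mul, rpow_add_one ht.ne']
  · ring
  · exact (intervalIntegrable_rpow_mul hα (by fun_prop) 0 1).const_mul _
  · exact (intervalIntegrable_rpow_mul hα (by fun_prop) 0 1).const_mul _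

lemma intervalIntegrable_rpow_mul_scaledFracDeriv (hα : -1 < α) {f f' : ℝ → ℝ}
    (hf : Continuous f) (hf' : Continuous f') (a b : ℝ) :
    IntervalIntegrable (fun t => t ^ α * scaledFracDeriv α f f' t) volume a b :=
  intervalIntegrable_rpow_mul hα (continuous_scaledFracDeriv hα hf hf') a b

lemma integral_rpow_mul_scaledFracDeriv (hα : -1 < α) {f f' : ℝ → ℝ}
    (hf : ∀ s, HasDerivAt f (f' s) s) (hf' : Continuous f') {T : ℝ} (hT : 0 ≤ T) :
    ∫ t in (0 : ℝ)..T, t ^ α * scaledFracDeriv α f f' t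
      = ∫ s in (0 : ℝ)..T, (T - s) ^ α * f s := by
  have hfc : Continuous f := continuous_iff_continuousAt.2 fun s => (hf s).continuousAt
  have hα' : 0 < α + 1 := by linarith
  rw [integral_eq_sub_of_hasDerivAt_of_le hT
    (f := fun τ => τ ^ (α + 1) * ∫ x in (0 : ℝ)..1, x ^ α * f (τ - τ * x)) _
    (fun t ht => hasDerivAt_rpow_mul_integral hα hf hf' ht.1)
    (intervalIntegrable_rpow_mul_scaledFracDeriv hα hfc hf' 0 T),
    integral_sub_rpow_mul hα'.ne' f hT]
  · simp [zero_rpow hα'.ne']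
  · exact ((continuous_rpow_const hα'.le).mul
      (continuous_integral_rpow_mul hα (g := fun t x => f (t - t * x))
        (by simp only [Function.uncurry_def]; fun_prop))).continuousOn

lemma integral_rpow_mul_sub_deriv_nonpos (hα₁ : -1 < α) (hα₂ : α < 0) {φ φ' : ℝ → ℝ}
    (hφ : ∀ x, HasDerivAt φ (φ' x) x) (hφ' : Continuous φ') (h0 : φ 0 = 0) :
    ∫ x in (0 : ℝ)..1, x ^ α * ((α + 1) * φ x ^ 2 - (1 - x) * (2 * φ x * φ' x)) ≤ 0 := by
  have hφc : Continuous φ := continuous_iff_continuousAt.2 fun s => (hφ s).continuousAt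
  have hcont : ContinuousOn (fun x => -(x ^ α * ((1 - x) * φ x ^ 2))) (Icc 0 1) := by
    have hd : Continuous (dslope φ 0) := by
      rw [← continuousOn_univ, continuousOn_dslope univ_mem]
      exact ⟨hφc.continuousOn, (hφ 0).differentiableAt⟩
    have hr : Continuous fun x : ℝ => x ^ (α + 2) := continuous_rpow_const (by linarith)
    have : Continuous fun x : ℝ => -(x ^ (α + 2) * ((1 - x) * dslope φ 0 x ^ 2)) := by fun_prop
    refine this.continuousOn.congr fun x hx => ?_
    have hs : φ x = x * dslope φ 0 x := by
      have := sub_smul_dslope φ 0 x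
      simp only [sub_zero, h0, smul_eq_mul] at this
      exact this.symm
    rcases hx.1.eq_or_lt with rfl | hx0
    · simp [h0, zero_rpow (show α + 2 ≠ 0 by linarith)]
    · simp only
      rw [hs, rpow_add hx0, rpow_two]
      ring
  have key := integral_le_sub_of_hasDeriv_right_of_le zero_le_one hcont
    (g' := fun x => -(α * x ^ (α - 1) * ((1 - x) * φ x ^ 2)
      + x ^ α * (-1 * φ x ^ 2 + (1 - x) * (2 * φ x * φ' x))))
    (φ := fun x => x ^ α * ((α + 1) * φ x ^ 2 - (1 - x) * (2 * φ x * φ' x))) ?_ ?_ ?_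
  · simpa [h0] using key
  · intro x hx
    have h1 := Real.hasDerivAt_rpow_const (x := x) (p := α) (.inl hx.1.ne')
    have h2 := ((hasDerivAt_id x).const_sub 1).mul ((hφ x).pow 2)
    have := (h1.mul h2).neg
    exact (this.congr_deriv (by simp [add_comm])).hasDerivWithinAt
  · rw [← intervalIntegrable_iff_integrableOn_Icc_of_le zero_le_one]
    exact intervalIntegrable_rpow_mul hα₁ (by fun_prop) 0 1
  · intro x hx
    have e : x ^ α = x ^ (α - 1) * x := by
      rw [← rpow_add_one hx.1.ne', sub_add_cancel]
    have hp : 0 ≤ x ^ (α - 1) * φ x ^ 2 * (-α) :=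
      mul_nonneg (mul_nonneg (rpow_nonneg hx.1.le _) (sq_nonneg _)) (by linarith)
    rw [e]
    linarith

lemma scaledFracDeriv_sq_le (hα₁ : -1 < α) (hα₂ : α < 0) {f f' : ℝ → ℝ}
    (hf : ∀ s, HasDerivAt f (f' s) s) (hf' : Continuous f') (t : ℝ) :
    scaledFracDeriv α (fun s => f s ^ 2) (fun s => 2 * f s * f' s) t + f t ^ 2
      ≤ 2 * f t * scaledFracDeriv α f f' t := by
  have hfc : Continuous f := continuous_iff_continuousAt.2 fun s => (hf s).continuousAt
  have key := integral_rpow_mul_sub_deriv_nonpos hα₁ hα₂ (φ := fun x => f (t - t * x) - f t)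
    (φ' := fun x => -t * f' (t - t * x)) (fun x => by
      have := ((hf (t - t * x)).comp x
        (((hasDerivAt_id x).const_mul t).const_sub t)).sub_const (f t)
      rw [mul_comm]
      simpa using this) (by fun_prop) (by simp)
  have h1 : ∫ x in (0 : ℝ)..1, x ^ α * ((α + 1) * f t ^ 2) = f t ^ 2 := by
    have : α + 1 ≠ 0 := by linarith
    rw [intervalIntegral.integral_mul_const, integral_rpow (.inl hα₁)]
    simp [zero_rpow this]
    field_simp
  rw [← sub_nonpos]
  rw [← h1]
  rw [scaledFracDeriv, scaledFracDeriv, ← intervalIntegral.integral_const_mul,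
    ← intervalIntegral.integral_add, ← intervalIntegral.integral_sub]
  · refine le_of_eq_of_le (intervalIntegral.integral_congr fun x _ => ?_) key
    ring
  · exact (intervalIntegrable_rpow_mul hα₁ (by fun_prop) 0 1).add
      (intervalIntegrable_rpow_mul hα₁ (by fun_prop) 0 1)
  · exact (intervalIntegrable_rpow_mul hα₁ (by fun_prop) 0 1).const_mul _
  · exact intervalIntegrable_rpow_mul hα₁ (by fun_prop) 0 1
  · exact intervalIntegrable_rpow_mul hα₁ (by fun_prop) 0 1

lemma two_mul_half_rpow_le (hα : α < 0) {s t : ℝ} (hs : 0 < s) (ht : 0 < t) :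
    2 * ((s + t) / 2) ^ α ≤ s ^ α + t ^ α := by
  have hm : 0 < (s + t) / 2 := by positivity
  have h1 : ((s + t) / 2) ^ α ≤ s ^ (α / 2) * t ^ (α / 2) := by
    have e : ((s + t) / 2) ^ α = (((s + t) / 2) ^ 2) ^ (α / 2) := by
      rw [← rpow_natCast_mul hm.le]; congr 1; push_cast; ring
    rw [e, ← mul_rpow hs.le ht.le]
    exact rpow_le_rpow_of_nonpos (by positivity) (by nlinarith [sq_nonneg (s - t)]) (by linarith)
  have h2 : ∀ r : ℝ, 0 < r → r ^ α = (r ^ (α / 2)) ^ 2 := fun r hr => by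
    rw [← rpow_mul_natCast hr.le]; congr 1; push_cast; ring
  rw [h2 s hs, h2 t ht]
  nlinarith [sq_nonneg (s ^ (α / 2) - t ^ (α / 2))]

lemma integral_mul_scaledFracDeriv_ge (hα₁ : -1 < α) (hα₂ : α < 0) {f f' : ℝ → ℝ}
    (hf : ∀ s, HasDerivAt f (f' s) s) (hf' : Continuous f') {T : ℝ} (hT : 0 ≤ T) :
    (T / 2) ^ α * ∫ t in (0 : ℝ)..T, f t ^ 2
      ≤ ∫ t in (0 : ℝ)..T, f t * (t ^ α * scaledFracDeriv α f f' t) := by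
  have hfc : Continuous f := continuous_iff_continuousAt.2 fun s => (hf s).continuousAt
  have hf2 : ∀ s, HasDerivAt (fun s => f s ^ 2) (2 * f s * f' s) s := fun s =>
    ((hf s).pow 2).congr_deriv (by simp)
  have hI1 : IntervalIntegrable
      (fun t => t ^ α * scaledFracDeriv α (fun s => f s ^ 2) (fun s => 2 * f s * f' s) t)
      volume 0 T :=
    intervalIntegrable_rpow_mul_scaledFracDeriv hα₁ (by fun_prop) (by fun_prop) 0 T
  have hI2 : IntervalIntegrable (fun t => t ^ α * f t ^ 2) volume 0 T :=
    intervalIntegrable_rpow_mul hα₁ (by fun_prop) 0 T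
  have hI3 : IntervalIntegrable (fun t => (T - t) ^ α * f t ^ 2) volume 0 T := by
    have := (intervalIntegrable_rpow' hα₁ (a := 0) (b := T)).comp_sub_left T
    simp only [sub_zero, sub_self] at this
    exact this.symm.mul_continuousOn (by fun_prop)
  have hI4 : IntervalIntegrable (fun t => f t * (t ^ α * scaledFracDeriv α f f' t))
      volume 0 T :=
    (intervalIntegrable_rpow_mul_scaledFracDeriv hα₁ hfc hf' 0 T).continuousOn_mul
      hfc.continuousOn
  have step1 : ∫ t in (0 : ℝ)..T, (t ^ α * scaledFracDeriv α (fun s => f s ^ 2)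
      (fun s => 2 * f s * f' s) t + t ^ α * f t ^ 2)
      ≤ ∫ t in (0 : ℝ)..T, 2 * (f t * (t ^ α * scaledFracDeriv α f f' t)) := by
    refine integral_mono_on_of_le_Ioo hT (hI1.add hI2) (hI4.const_mul 2) fun t ht => ?_
    have := mul_le_mul_of_nonneg_left (scaledFracDeriv_sq_le hα₁ hα₂ hf hf' t)
      (rpow_nonneg ht.1.le α)
    linarith
  have step2 : ∫ t in (0 : ℝ)..T, 2 * (T / 2) ^ α * f t ^ 2
      ≤ ∫ t in (0 : ℝ)..T, ((T - t) ^ α * f t ^ 2 + t ^ α * f t ^ 2) := by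
    refine integral_mono_on_of_le_Ioo hT (Continuous.intervalIntegrable (by fun_prop) 0 T)
      (hI3.add hI2) fun t ht => ?_
    have := two_mul_half_rpow_le hα₂ (sub_pos.2 ht.2) ht.1
    rw [sub_add_cancel] at this
    rw [← add_mul]
    exact mul_le_mul_of_nonneg_right this (sq_nonneg _)
  rw [intervalIntegral.integral_add hI1 hI2, integral_rpow_mul_scaledFracDeriv hα₁ hf2
    (by fun_prop) hT, intervalIntegral.integral_const_mul] at step1
  rw [intervalIntegral.integral_add hI3 hI2, intervalIntegral.integral_const_mul] at step2
  linarith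

end FractionalDerivative

section Constant

lemma cos_mul_pi_div_two_le {x : ℝ} (h0 : 0 ≤ x) (h1 : x ≤ 1) : cos (x * π / 2) ≤ 1 - x ^ 2 := by
  have hs : x * (√2 / 2) ≤ sin (x * (π / 4)) := by
    have := strictConcaveOn_sin_Icc.concaveOn.2 (x := 0) (y := π / 4)
      ⟨le_rfl, pi_pos.le⟩ ⟨by positivity, by linarith [pi_pos]⟩ (sub_nonneg.2 h1) h0 (by ring)
    simpa using this
  have hsq : (x * (√2 / 2)) ^ 2 ≤ sin (x * (π / 4)) ^ 2 :=
    pow_le_pow_left₀ (by positivity) hs 2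
  rw [mul_pow, div_pow, sq_sqrt zero_le_two] at hsq
  rw [show x * π / 2 = 2 * (x * (π / 4)) by ring, cos_two_mul, cos_sq']
  linarith

lemma mul_Gamma_le_one {x : ℝ} (h0 : 0 < x) (h1 : x ≤ 1) : x * Gamma x ≤ 1 := by
  rw [← Gamma_add_one h0.ne']
  have := convexOn_Gamma.2 (x := 1) (y := 2) (by simp) (by simp)
    (sub_nonneg.2 h1) h0.le (by ring)
  simp only [smul_eq_mul, Gamma_one, Gamma_two] at this
  rwa [show (1 - x) * 1 + x * 2 = x + 1 by ring, show (1 - x) * 1 + x * 1 = 1 by ring] at this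

lemma coercivity_const_le {α : ℝ} (hα₁ : -1 < α) (hα₂ : α < 0) :
    (cos (α * π / 2) / π ^ α) * (|α| ^ (-α) / (1 - α) ^ (1 - α))
      ≤ (1 / 2) ^ α / Gamma (α + 1) := by
  obtain ⟨β, rfl⟩ : ∃ β, α = -β := ⟨-α, by ring⟩
  have hβ0 : 0 < β := by linarith
  have hβ1 : β < 1 := by linarith
  have hG : 0 < Gamma (-β + 1) := Gamma_pos_of_pos (by linarith)
  have hcos : cos (-β * π / 2) * Gamma (-β + 1) ≤ 1 + β := by
    have h1 : cos (-β * π / 2) ≤ 1 - β ^ 2 := by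
      rw [show -β * π / 2 = -(β * π / 2) by ring, cos_neg]
      exact cos_mul_pi_div_two_le hβ0.le hβ1.le
    have h2 := mul_Gamma_le_one (x := -β + 1) (by linarith) (by linarith)
    nlinarith [mul_le_mul_of_nonneg_right h1 hG.le]
  rw [le_div_iff₀ hG, abs_neg, abs_of_pos hβ0, neg_neg, rpow_neg pi_pos.le, div_inv_eq_mul,
    sub_neg_eq_add, one_div, inv_rpow zero_le_two, rpow_neg zero_le_two, inv_inv,
    rpow_add (by linarith : (0 : ℝ) < 1 + β), rpow_one]
  have hle : π ^ β * β ^ β ≤ 2 ^ β * (1 + β) ^ β := by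
    rw [← mul_rpow pi_pos.le hβ0.le, ← mul_rpow zero_le_two (by linarith)]
    exact rpow_le_rpow (by positivity) (by nlinarith [pi_lt_four]) hβ0.le
  have hpos : 0 < (1 + β) ^ β := rpow_pos_of_pos (by linarith) _
  calc cos (-β * π / 2) * π ^ β * (β ^ β / ((1 + β) * (1 + β) ^ β)) * Gamma (-β + 1)
      = (cos (-β * π / 2) * Gamma (-β + 1)) * (π ^ β * β ^ β)
          / ((1 + β) * (1 + β) ^ β) := by ring
    _ ≤ (1 + β) * (2 ^ β * (1 + β) ^ β) / ((1 + β) * (1 + β) ^ β) := by gcongr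
    _ = 2 ^ β := by field_simp

end Constant

lemma exists_hasDerivAt_extension {T : ℝ} (hT : 0 ≤ T) {v v' : ℝ → ℝ}
    (hv : ∀ s ∈ Icc (0 : ℝ) T, HasDerivAt v (v' s) s) (hv' : ContinuousOn v' (Icc 0 T)) :
    ∃ f f' : ℝ → ℝ, Continuous f' ∧ (∀ s, HasDerivAt f (f' s) s) ∧ EqOn f v (Icc 0 T) := by
  have hc : Continuous (IccExtend hT ((Icc 0 T).domRestrict v')) :=
    (continuousOn_iff_continuous_domRestrict.1 hv').Icc_extend'
  refine ⟨fun s => v 0 + ∫ x in (0 : ℝ)..s, IccExtend hT ((Icc 0 T).domRestrict v') x, _, hc,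
    fun s => (hc.integral_hasStrictDerivAt 0 s).hasDerivAt.const_add _, fun t ht => ?_⟩
  have hsub : uIcc 0 t ⊆ Icc 0 T := by
    rw [uIcc_of_le ht.1]; exact Icc_subset_Icc_right ht.2
  have : ∫ x in (0 : ℝ)..t, IccExtend hT ((Icc 0 T).domRestrict v') x = v t - v 0 := by
    refine integral_eq_sub_of_hasDerivAt (fun s hs => ?_) (hc.intervalIntegrable 0 t)
    rw [IccExtend_of_mem hT _ (hsub hs)]
    exact hv s (hsub hs)
  simp only [this]
  ring

open Real intervalIntegral Set

/-- Coercivity: for `-1 < α < 0`, `T > 0`,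
`c_α = (cos(απ/2)/π^α) · (|α|^(-α)/(1-α)^(1-α))`, and every `v ∈ C¹([0,T])`,
`∫₀ᵀ v 𝓑_α v ≥ c_α T^α ∫₀ᵀ v²`. -/
theorem stmt_7 (α T : ℝ) (hα₁ : -1 < α) (hα₂ : α < 0) (hT : 0 < T)
    (v v' : ℝ → ℝ)
    (hv : ∀ s ∈ Set.Icc (0:ℝ) T, HasDerivAt v (v' s) s)
    (hv' : ContinuousOn v' (Set.Icc 0 T)) :
    (Real.cos (α * Real.pi / 2) / Real.pi ^ α) * (|α| ^ (-α) / (1 - α) ^ (1 - α))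
        * T ^ α * ∫ t in (0:ℝ)..T, v t ^ 2
      ≤ ∫ t in (0:ℝ)..T,
          v t * deriv (fun τ => ∫ s in (0:ℝ)..τ, ((τ - s) ^ α / Real.Gamma (α + 1)) * v s) t := by

  obtain ⟨f, f', hf', hf, hfv⟩ := exists_hasDerivAt_extension hT.le hv hv'
  have hG : 0 < Real.Gamma (α + 1) := Gamma_pos_of_pos (by linarith)
  have hsq : ∫ t in (0:ℝ)..T, v t ^ 2 = ∫ t in (0:ℝ)..T, f t ^ 2 :=
    intervalIntegral.integral_congr fun t ht => by
      rw [uIcc_of_le hT.le] at ht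
      simp only [hfv ht]
  have hconv : ∀ τ ∈ Ioo 0 T,
      ∫ s in (0:ℝ)..τ, ((τ - s) ^ α / Real.Gamma (α + 1)) * v s
        = (τ ^ (α + 1) * ∫ x in (0 : ℝ)..1, x ^ α * f (τ - τ * x)) / Real.Gamma (α + 1) := by
    intro τ hτ
    rw [← integral_sub_rpow_mul (by linarith) f hτ.1.le, ← intervalIntegral.integral_div]
    refine intervalIntegral.integral_congr fun s hs => ?_
    rw [uIcc_of_le hτ.1.le] at hs
    simp only [hfv ⟨hs.1, hs.2.trans hτ.2.le⟩]
    ring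
  have hderiv : ∫ t in (0:ℝ)..T,
      v t * deriv (fun τ => ∫ s in (0:ℝ)..τ, ((τ - s) ^ α / Real.Gamma (α + 1)) * v s) t
      = (∫ t in (0:ℝ)..T, f t * (t ^ α * scaledFracDeriv α f f' t)) / Real.Gamma (α + 1) := by
    rw [← intervalIntegral.integral_div]
    simp only [integral_of_le hT.le, integral_Ioc_eq_integral_Ioo]
    refine setIntegral_congr_fun measurableSet_Ioo fun t ht => ?_
    have hd := ((hasDerivAt_rpow_mul_integral hα₁ hf hf' ht.1).div_const
      (Real.Gamma (α + 1))).congr_of_eventuallyEq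
        (Filter.eventually_of_mem (Ioo_mem_nhds ht.1 ht.2) hconv)
    simp only [hd.deriv, hfv ⟨ht.1.le, ht.2.le⟩]
    ring
  rw [hsq, hderiv, le_div_iff₀ hG]
  have hc := coercivity_const_le hα₁ hα₂
  rw [le_div_iff₀ hG] at hc
  refine le_trans ?_ (integral_mul_scaledFracDeriv_ge hα₁ hα₂ hf hf' hT.le)
  have hI : 0 ≤ ∫ t in (0:ℝ)..T, f t ^ 2 :=
    intervalIntegral.integral_nonneg hT.le fun t _ => sq_nonneg _
  rw [div_eq_mul_one_div T 2, mul_rpow hT.le (by norm_num)]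
  calc _ = Real.cos (α * Real.pi / 2) / Real.pi ^ α * (|α| ^ (-α) / (1 - α) ^ (1 - α))
          * Real.Gamma (α + 1) * (T ^ α * ∫ t in (0:ℝ)..T, f t ^ 2) := by ring
    _ ≤ (1 / 2) ^ α * (T ^ α * ∫ t in (0:ℝ)..T, f t ^ 2) :=
        mul_le_mul_of_nonneg_right hc (mul_nonneg (rpow_nonneg hT.le α) hI)
    _ = _ := by ring
end

section
/- Let $-1<\alpha<0$, $T>0$, and set $d_\alpha = 1/\cos(\alpha\pi/2)$. Then for all $v,w\in \mathcal C^1([0,T])$, $\int_0^T v(t)\,w(t)\,dt \;\le\; d_\alpha \left(\int_0^T v\,\mathcal B_\alpha v\,dt\right)^{1/2} \left(\int_0^T w\,\mathcal I_{-\alpha} w\,dt\right)^{1/2}$. -/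
open Real intervalIntegral Set

section

open MeasureTheory ProbabilityTheory

/-- The causal power kernel `r₊ ^ (a - 1)`. -/
noncomputable def posPow (a r : ℝ) : ℝ := if 0 < r then r ^ (a - 1) else 0

lemma posPow_nonneg (a r : ℝ) : 0 ≤ posPow a r := by
  unfold posPow
  split_ifs with h
  · exact rpow_nonneg h.le _
  · exact le_rfl

lemma posPow_of_pos (a : ℝ) {r : ℝ} (hr : 0 < r) : posPow a r = r ^ (a - 1) := if_pos hr

lemma posPow_of_nonpos (a : ℝ) {r : ℝ} (hr : r ≤ 0) : posPow a r = 0 := if_neg hr.not_gt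

@[fun_prop]
lemma measurable_posPow (a : ℝ) : Measurable (posPow a) :=
  Measurable.ite measurableSet_Ioi (by fun_prop) (by fun_prop)

lemma posPow_mul (a : ℝ) {c : ℝ} (hc : 0 < c) (r : ℝ) :
    posPow a (c * r) = c ^ (a - 1) * posPow a r := by
  rcases le_or_gt r 0 with hr | hr
  · rw [posPow_of_nonpos a hr, posPow_of_nonpos a (mul_nonpos_of_nonneg_of_nonpos hc.le hr),
      mul_zero]
  · rw [posPow_of_pos a hr, posPow_of_pos a (mul_pos hc hr), mul_rpow hc.le hr.le]

lemma posPow_mul_posPow_one_sub {a b : ℝ} (ha : 0 < a) (hb : 0 < b) (x : ℝ) :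
    posPow a x * posPow b (1 - x) = beta a b * betaPDFReal a b x := by
  have := (beta_pos ha hb).ne'
  unfold betaPDFReal
  split_ifs with h
  · rw [posPow_of_pos a h.1, posPow_of_pos b (by linarith [h.2])]
    field_simp
  · rw [mul_zero]
    rcases le_or_gt x 0 with hx | hx
    · rw [posPow_of_nonpos a hx, zero_mul]
    · rw [posPow_of_nonpos b (r := 1 - x) (by grind), mul_zero]

lemma betaPDFReal_nonneg {a b : ℝ} (ha : 0 < a) (hb : 0 < b) (x : ℝ) : 0 ≤ betaPDFReal a b x := by
  by_cases h : 0 < x ∧ x < 1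
  · exact (betaPDFReal_pos h.1 h.2 ha hb).le
  · rw [betaPDFReal, if_neg h]

lemma integrable_betaPDFReal {a b : ℝ} (ha : 0 < a) (hb : 0 < b) :
    Integrable (betaPDFReal a b) := by
  refine ⟨(measurable_betaPDFReal a b).aestronglyMeasurable, ?_⟩
  rw [hasFiniteIntegral_iff_ofReal (ae_of_all _ (betaPDFReal_nonneg ha hb))]
  have := lintegral_betaPDF_eq_one ha hb
  simp only [betaPDF] at this
  rw [this]
  exact ENNReal.one_lt_top

lemma integral_betaPDFReal {a b : ℝ} (ha : 0 < a) (hb : 0 < b) :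
    ∫ x, betaPDFReal a b x = 1 := by
  rw [integral_eq_lintegral_of_nonneg_ae (ae_of_all _ (betaPDFReal_nonneg ha hb))
    (measurable_betaPDFReal a b).aestronglyMeasurable]
  have := lintegral_betaPDF_eq_one ha hb
  simp only [betaPDF] at this
  rw [this, ENNReal.toReal_one]

lemma hasConv_posPow {a b : ℝ} (ha : 0 < a) (hb : 0 < b) (s t : ℝ) :
    Integrable (fun x => posPow a (x - s) * posPow b (t - x)) ∧
      ∫ x, posPow a (x - s) * posPow b (t - x) = beta a b * posPow (a + b) (t - s) := by
  rcases le_or_gt t s with hts | hts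
  · have h0 : (fun x => posPow a (x - s) * posPow b (t - x)) = fun _ => 0 := by
      ext x
      rcases le_or_gt x s with hx | hx
      · rw [posPow_of_nonpos a (by linarith), zero_mul]
      · rw [posPow_of_nonpos b (r := t - x) (by linarith), mul_zero]
    rw [h0, posPow_of_nonpos _ (by linarith)]
    simp
  · have hc : 0 < t - s := by linarith
    have h0 : (fun x => posPow a (x - s) * posPow b (t - x)) = fun x =>
        ((t - s) ^ (a - 1) * (t - s) ^ (b - 1) * beta a b) *
          betaPDFReal a b ((x - s) / (t - s)) := by
      ext x
      rw [mul_assoc, ← posPow_mul_posPow_one_sub ha hb, mul_mul_mul_comm, ← posPow_mul a hc,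
        ← posPow_mul b hc]
      congr 2 <;> field_simp
      ring
    rw [h0]
    refine ⟨(((integrable_betaPDFReal ha hb).comp_div hc.ne').comp_sub_right s).const_mul _, ?_⟩
    rw [MeasureTheory.integral_const_mul, integral_sub_right_eq_self (fun x => betaPDFReal a b (x / (t - s))) s,
      Measure.integral_comp_div, integral_betaPDFReal ha hb, abs_of_pos hc, posPow_of_pos _ hc,
      show a + b - 1 = (a - 1) + (b - 1) + 1 by ring, rpow_add hc, rpow_add hc, rpow_one]
    simp only [smul_eq_mul]
    ring

lemma image_div_one_sub : (fun y : ℝ => y / (1 - y)) '' Ioo 0 1 = Ioi 0 := by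
  ext x
  simp only [mem_image, mem_Ioo, mem_Ioi]
  constructor
  · rintro ⟨y, ⟨h0, h1⟩, rfl⟩
    exact div_pos h0 (by linarith)
  · intro hx
    refine ⟨x / (1 + x), ⟨by positivity, (div_lt_one (by positivity)).2 (by linarith)⟩, ?_⟩
    field_simp
    ring

lemma hasIntegral_posPow_one_add {a b : ℝ} (ha : 0 < a) (hb : 0 < b) :
    Integrable (fun x => posPow a x * posPow (1 - a - b) (1 + x)) ∧
      ∫ x, posPow a x * posPow (1 - a - b) (1 + x) = beta a b := by
  have hd : ∀ y ∈ Ioo (0:ℝ) 1, HasDerivWithinAt (fun y : ℝ => y / (1 - y))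
      (1 / (1 - y) ^ 2) (Ioo 0 1) y := by
    intro y hy
    have h1 : 1 - y ≠ 0 := by linarith [hy.2]
    have h := ((hasDerivAt_id' y).fun_div ((hasDerivAt_id' y).const_sub 1) h1)
    rw [show 1 * (1 - y) - y * -1 = 1 by ring] at h
    exact h.hasDerivWithinAt
  have hinj : InjOn (fun y : ℝ => y / (1 - y)) (Ioo 0 1) := by
    intro y hy z hz h
    have h1 : 1 - y ≠ 0 := by linarith [hy.2]
    have h2 : 1 - z ≠ 0 := by linarith [hz.2]
    simp only at h
    rw [div_eq_div_iff h1 h2] at h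
    linarith
  have hcongr : EqOn (fun y : ℝ => |1 / (1 - y) ^ 2| •
      (posPow a (y / (1 - y)) * posPow (1 - a - b) (1 + y / (1 - y))))
      (fun y => beta a b * betaPDFReal a b y) (Ioo 0 1) := by
    intro y hy
    have h1 : 0 < 1 - y := by linarith [hy.2]
    have h2 : 1 + y / (1 - y) = (1 - y)⁻¹ := by field_simp; ring
    simp only [smul_eq_mul]
    rw [← posPow_mul_posPow_one_sub ha hb, h2, div_eq_inv_mul y, posPow_mul a (inv_pos.2 h1),
      posPow_of_pos _ (inv_pos.2 h1), posPow_of_pos b h1, inv_rpow h1.le, inv_rpow h1.le,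
      abs_of_pos (by positivity), ← rpow_neg h1.le, ← rpow_neg h1.le, one_div,
      show ((1 - y) ^ 2)⁻¹ = (1 - y) ^ (-2 : ℝ) by rw [rpow_neg h1.le, rpow_two],
      show b - 1 = -2 + (-(a - 1)) + (-(1 - a - b - 1)) by ring, rpow_add h1, rpow_add h1]
    ring
  have hsupp : ∀ x ∉ Ioi (0:ℝ), posPow a x * posPow (1 - a - b) (1 + x) = 0 := by
    intro x hx
    rw [posPow_of_nonpos a (not_lt.1 hx), zero_mul]
  have hsupp' : ∀ x ∉ Ioo (0:ℝ) 1, beta a b * betaPDFReal a b x = 0 := by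
    intro x hx
    rw [betaPDFReal, if_neg (by exact hx), mul_zero]
  constructor
  · rw [← integrableOn_iff_integrable_of_support_subset (s := Ioi 0)
      (fun x hx => by_contra fun h => hx (hsupp x h)), ← image_div_one_sub,
      integrableOn_image_iff_integrableOn_abs_deriv_smul measurableSet_Ioo hd hinj,
      integrableOn_congr_fun hcongr measurableSet_Ioo]
    exact ((integrable_betaPDFReal ha hb).const_mul _).integrableOn
  · rw [← setIntegral_eq_integral_of_forall_compl_eq_zero hsupp, ← image_div_one_sub,
      integral_image_eq_integral_abs_deriv_smul measurableSet_Ioo hd hinj,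
      setIntegral_congr_fun measurableSet_Ioo hcongr,
      setIntegral_eq_integral_of_forall_compl_eq_zero hsupp', MeasureTheory.integral_const_mul,
      integral_betaPDFReal ha hb, mul_one]

lemma hasCorr_posPow_of_lt {β : ℝ} (h0 : 0 < β) (h1 : 2 * β < 1) {s t : ℝ} (hst : s < t) :
    Integrable (fun x => posPow β (x - s) * posPow β (x - t)) ∧
      ∫ x, posPow β (x - s) * posPow β (x - t) =
        beta β (1 - 2 * β) * posPow (2 * β) (t - s) := by
  have hc : 0 < t - s := by linarith
  obtain ⟨hi, hv⟩ := hasIntegral_posPow_one_add h0 (b := 1 - 2 * β) (by linarith)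
  rw [show 1 - β - (1 - 2 * β) = β by ring] at hi hv
  have h : (fun x => posPow β (x - s) * posPow β (x - t)) = fun x =>
      ((t - s) ^ (β - 1) * (t - s) ^ (β - 1)) *
        (posPow β ((x - t) / (t - s)) * posPow β (1 + (x - t) / (t - s))) := by
    ext x
    rw [mul_mul_mul_comm, ← posPow_mul β hc, ← posPow_mul β hc, mul_comm]
    congr 2 <;> field_simp
    ring
  rw [h]
  refine ⟨((hi.comp_div hc.ne').comp_sub_right t).const_mul _, ?_⟩
  rw [MeasureTheory.integral_const_mul, integral_sub_right_eq_self
      (fun x => posPow β (x / (t - s)) * posPow β (1 + x / (t - s))) t,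
    Measure.integral_comp_div (fun x => posPow β x * posPow β (1 + x)), hv, abs_of_pos hc,
    posPow_of_pos _ hc, show 2 * β - 1 = (β - 1) + (β - 1) + 1 by ring, rpow_add hc, rpow_add hc,
    rpow_one, smul_eq_mul]
  ring

lemma hasCorr_posPow {β : ℝ} (h0 : 0 < β) (h1 : 2 * β < 1) {s t : ℝ} (hst : s ≠ t) :
    Integrable (fun x => posPow β (x - s) * posPow β (x - t)) ∧
      ∫ x, posPow β (x - s) * posPow β (x - t) =
        beta β (1 - 2 * β) * (posPow (2 * β) (t - s) + posPow (2 * β) (s - t)) := by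
  rcases hst.lt_or_gt with h | h
  · rw [posPow_of_nonpos _ (by linarith : s - t ≤ 0), add_zero]
    exact hasCorr_posPow_of_lt h0 h1 h
  · rw [posPow_of_nonpos _ (by linarith : t - s ≤ 0), zero_add]
    simp_rw [mul_comm (posPow β (_ - s))]
    exact hasCorr_posPow_of_lt h0 h1 h

lemma hasCorr_posPow_reflect {β : ℝ} (h0 : 0 < β) (h1 : 2 * β < 1) {s t : ℝ} (hst : s ≠ t) :
    Integrable (fun x => posPow β (s - x) * posPow β (t - x)) ∧
      ∫ x, posPow β (s - x) * posPow β (t - x) =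
        beta β (1 - 2 * β) * (posPow (2 * β) (t - s) + posPow (2 * β) (s - t)) := by
  obtain ⟨hi, hv⟩ := hasCorr_posPow h0 h1 (neg_injective.ne hst)
  have h : (fun x => posPow β (s - x) * posPow β (t - x)) =
      fun x => (fun y => posPow β (y - -s) * posPow β (y - -t)) (-x) := by
    ext x
    simp only
    congr 2 <;> ring
  rw [h]
  refine ⟨hi.comp_neg, ?_⟩
  rw [integral_neg_eq_self (fun y => posPow β (y - -s) * posPow β (y - -t)), hv, add_comm]
  congr 3 <;> ring

/-- Fubini for a product of two integral transforms. -/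
lemma integral_transform_mul_transform {A B C : ℝ → ℝ → ℝ} {f g : ℝ → ℝ}
    (hA : Measurable (Function.uncurry A)) (hB : Measurable (Function.uncurry B))
    (hA0 : ∀ x s, 0 ≤ A x s) (hB0 : ∀ x s, 0 ≤ B x s)
    (hf : AEStronglyMeasurable f) (hg : AEStronglyMeasurable g)
    (hAB : ∀ᵐ p : ℝ × ℝ, Integrable (fun x => A x p.1 * B x p.2) ∧
      ∫ x, A x p.1 * B x p.2 = C p.1 p.2)
    (hC : Integrable fun p : ℝ × ℝ => f p.1 * g p.2 * C p.1 p.2) :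
    Integrable (fun x => (∫ s, A x s * f s) * ∫ t, B x t * g t) ∧
      ∫ x, (∫ s, A x s * f s) * ∫ t, B x t * g t =
        ∫ p : ℝ × ℝ, f p.1 * g p.2 * C p.1 p.2 := by
  have hprod : ∀ x, ∫ p : ℝ × ℝ, f p.1 * g p.2 * (A x p.1 * B x p.2) =
      (∫ s, A x s * f s) * ∫ t, B x t * g t := by
    intro x
    rw [← integral_prod_mul, Measure.volume_eq_prod]
    exact integral_congr_ae (ae_of_all _ fun p => by ring)
  have hm : AEStronglyMeasurable (fun z : (ℝ × ℝ) × ℝ => f z.1.1 * g z.1.2 *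
      (A z.2 z.1.1 * B z.2 z.1.2)) (volume.prod volume) := by
    have h1 : AEStronglyMeasurable (fun p : ℝ × ℝ => f p.1 * g p.2) :=
      hf.comp_fst.mul hg.comp_snd
    have h2 : Measurable (fun z : (ℝ × ℝ) × ℝ => A z.2 z.1.1 * B z.2 z.1.2) :=
      (hA.comp (by fun_prop : Measurable fun z : (ℝ × ℝ) × ℝ => (z.2, z.1.1))).mul
        (hB.comp (by fun_prop : Measurable fun z : (ℝ × ℝ) × ℝ => (z.2, z.1.2)))
    exact h1.comp_fst.mul h2.aestronglyMeasurable
  have hint : Integrable (fun z : (ℝ × ℝ) × ℝ => f z.1.1 * g z.1.2 *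
      (A z.2 z.1.1 * B z.2 z.1.2)) (volume.prod volume) := by
    rw [integrable_prod_iff hm]
    refine ⟨hAB.mono fun p hp => hp.1.const_mul (f p.1 * g p.2), hC.norm.congr ?_⟩
    filter_upwards [hAB] with p hp
    have : 0 ≤ C p.1 p.2 := hp.2 ▸ integral_nonneg fun x => mul_nonneg (hA0 _ _) (hB0 _ _)
    simp_rw [norm_mul, fun x => norm_of_nonneg (hA0 x p.1), fun x => norm_of_nonneg (hB0 x p.2),
      MeasureTheory.integral_const_mul, hp.2, norm_of_nonneg this]
  constructor
  · exact hint.integral_prod_right.congr (ae_of_all _ hprod)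
  · simp_rw [← hprod]
    rw [← integral_integral_swap (f := fun (p : ℝ × ℝ) x => f p.1 * g p.2 *
      (A x p.1 * B x p.2)) hint]
    refine integral_congr_ae ?_
    filter_upwards [hAB] with p hp
    rw [MeasureTheory.integral_const_mul, hp.2]

/-- The bilinear form `∫∫ f(s) g(t) (t - s)₊ ^ (μ - 1) ds dt`. -/
noncomputable def causalForm (μ : ℝ) (f g : ℝ → ℝ) : ℝ :=
  ∫ p : ℝ × ℝ, f p.1 * g p.2 * posPow μ (p.2 - p.1)

/-- The power `t ^ (-μ)` cut off to `(0, T]`. -/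
noncomputable def powWeight (μ T : ℝ) : ℝ → ℝ := (Ioc 0 T).indicator (posPow (1 - μ))

lemma powWeight_nonneg (μ T t : ℝ) : 0 ≤ powWeight μ T t :=
  indicator_nonneg (fun t _ => posPow_nonneg _ t) t

@[fun_prop]
lemma measurable_powWeight (μ T : ℝ) : Measurable (powWeight μ T) :=
  (measurable_posPow _).indicator measurableSet_Ioc

lemma integrable_powWeight {μ : ℝ} (hμ1 : μ < 1) {T : ℝ} (hT : 0 < T) :
    Integrable (powWeight μ T) := by
  rw [powWeight, integrable_indicator_iff measurableSet_Ioc]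
  have h : IntegrableOn (fun t : ℝ => t ^ (-μ)) (Ioc 0 T) := by
    rw [← intervalIntegrable_iff_integrableOn_Ioc_of_le hT.le]
    exact intervalIntegral.intervalIntegrable_rpow' (by linarith)
  refine h.congr_fun (fun t ht => ?_) measurableSet_Ioc
  simp only
  rw [posPow_of_pos _ ht.1]
  congr 1
  ring

lemma integrable_powWeight_form {μ : ℝ} (hμ0 : 0 < μ) (hμ1 : μ < 1) {T : ℝ} (hT : 0 < T) :
    Integrable fun p : ℝ × ℝ =>
      powWeight μ T p.1 * powWeight μ T p.2 * posPow μ (p.2 - p.1) := by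
  have hm : Measurable fun p : ℝ × ℝ =>
      powWeight μ T p.1 * powWeight μ T p.2 * posPow μ (p.2 - p.1) := by fun_prop
  have key : ∀ y x, powWeight μ T x * powWeight μ T y * posPow μ (y - x) =
      powWeight μ T y * (posPow (1 - μ) (x - 0) * posPow μ (y - x)) := by
    intro y x
    unfold powWeight
    by_cases hy : y ∈ Ioc 0 T
    · by_cases hx : x ∈ Ioc 0 T
      · rw [indicator_of_mem hx, sub_zero]
        ring
      · rw [indicator_of_notMem hx]
        rcases le_or_gt x 0 with h | h
        · rw [sub_zero, posPow_of_nonpos _ h]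
          ring
        · have : T < x := by
            by_contra hc
            exact hx ⟨h, not_lt.1 hc⟩
          rw [posPow_of_nonpos μ (r := y - x) (by linarith [hy.2])]
          ring
    · rw [indicator_of_notMem hy]
      ring
  have hc := fun y => hasConv_posPow (a := 1 - μ) (b := μ) (by linarith) hμ0 0 y
  rw [Measure.volume_eq_prod, integrable_prod_iff' hm.aestronglyMeasurable]
  constructor
  · refine ae_of_all _ fun y => ?_
    simp only [key]
    exact (hc y).1.const_mul _
  · refine ((integrable_powWeight hμ1 hT).const_mul (beta (1 - μ) μ)).congr
      (ae_of_all _ fun y => ?_)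
    have h0 : ∀ x, 0 ≤ powWeight μ T x * powWeight μ T y * posPow μ (y - x) := fun x =>
      mul_nonneg (mul_nonneg (powWeight_nonneg _ _ _) (powWeight_nonneg _ _ _))
        (posPow_nonneg _ _)
    simp_rw [fun x => norm_of_nonneg (h0 x), key]
    rw [MeasureTheory.integral_const_mul, (hc y).2]
    by_cases hy : y ∈ Ioc 0 T
    · rw [posPow_of_pos (1 - μ + μ) (by linarith [hy.1])]
      simp [mul_comm]
    · simp [powWeight, indicator_of_notMem hy]

lemma integrable_causalForm {μ : ℝ} (hμ0 : 0 < μ) (hμ1 : μ < 1) {T : ℝ} (hT : 0 < T)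
    {f g : ℝ → ℝ} {C D : ℝ} (hf : AEStronglyMeasurable f) (hg : AEStronglyMeasurable g)
    (hfC : ∀ t, |f t| ≤ C * powWeight μ T t) (hgD : ∀ t, |g t| ≤ D * powWeight μ T t) :
    Integrable fun p : ℝ × ℝ => f p.1 * g p.2 * posPow μ (p.2 - p.1) := by
  refine ((integrable_powWeight_form hμ0 hμ1 hT).const_mul (C * D)).mono'
    ((hf.comp_fst.mul hg.comp_snd).mul
      (Measurable.aestronglyMeasurable (by fun_prop))) (ae_of_all _ fun p => ?_)
  rw [norm_mul, norm_mul, norm_of_nonneg (posPow_nonneg _ _), norm_eq_abs, norm_eq_abs,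
    show C * D * (powWeight μ T p.1 * powWeight μ T p.2 * posPow μ (p.2 - p.1)) =
      (C * powWeight μ T p.1) * (D * powWeight μ T p.2) * posPow μ (p.2 - p.1) by ring]
  exact mul_le_mul_of_nonneg_right (mul_le_mul (hfC _) (hgD _) (abs_nonneg _)
    ((abs_nonneg _).trans (hfC _))) (posPow_nonneg _ _)

lemma ae_fst_ne_snd : ∀ᵐ p : ℝ × ℝ, p.1 ≠ p.2 := by
  have : MeasurableSet {p : ℝ × ℝ | p.1 = p.2} := measurableSet_eq_fun measurable_fst measurable_snd
  rw [ae_iff]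
  simp only [ne_eq, not_not]
  rw [Measure.volume_eq_prod, Measure.measure_prod_null this]
  refine ae_of_all _ fun x => ?_
  have h : Prod.mk x ⁻¹' {p : ℝ × ℝ | p.1 = p.2} = {x} := by
    ext y
    simp [eq_comm]
  simp [h]

lemma integral_mul_le_sqrt_mul_sqrt {X : Type*} [MeasurableSpace X] {ν : Measure X}
    {P M : X → ℝ} (hPP : Integrable (fun x => P x * P x) ν)
    (hMM : Integrable (fun x => M x * M x) ν) (hPM : Integrable (fun x => P x * M x) ν) :
    ∫ x, P x * M x ∂ν ≤ √(∫ x, P x * P x ∂ν) * √(∫ x, M x * M x ∂ν) := by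
  have h0 : 0 ≤ ∫ x, P x * P x ∂ν := integral_nonneg fun x => mul_self_nonneg _
  have hd : discrim (∫ x, M x * M x ∂ν) (-2 * ∫ x, P x * M x ∂ν) (∫ x, P x * P x ∂ν) ≤ 0 := by
    refine discrim_le_zero fun c => ?_
    have h : ∫ x, (P x - c * M x) * (P x - c * M x) ∂ν =
        (∫ x, M x * M x ∂ν) * (c * c) + (-2 * ∫ x, P x * M x ∂ν) * c + ∫ x, P x * P x ∂ν := by
      have h' : ∀ x, (P x - c * M x) * (P x - c * M x) =
          c * c * (M x * M x) + -2 * c * (P x * M x) + P x * P x := fun x => by ring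
      simp_rw [h']
      have hi : Integrable (fun x => c * c * (M x * M x) + -2 * c * (P x * M x)) ν :=
        (hMM.const_mul _).add (hPM.const_mul _)
      rw [integral_add hi hPP,
        integral_add (hMM.const_mul _) (hPM.const_mul _), MeasureTheory.integral_const_mul,
        MeasureTheory.integral_const_mul]
      ring
    rw [← h]
    exact integral_nonneg fun x => mul_self_nonneg _
  rw [← sqrt_mul h0]
  refine le_sqrt_of_sq_le ?_
  unfold discrim at hd
  nlinarith

lemma two_mul_beta_div_beta {β : ℝ} (h0 : 0 < β) (h1 : 2 * β < 1) :
    2 * beta β (1 - 2 * β) = beta β β * (1 / cos (π * β)) := by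
  have hs : 0 < sin (π * β) := sin_pos_of_pos_of_lt_pi (by positivity) (by nlinarith [pi_pos])
  have hc : 0 < cos (π * β) := cos_pos_of_mem_Ioo ⟨by nlinarith [pi_pos], by nlinarith [pi_pos]⟩
  have e1 := Gamma_mul_Gamma_one_sub β
  have e2 := Gamma_mul_Gamma_one_sub (2 * β)
  rw [show π * (2 * β) = 2 * (π * β) by ring, sin_two_mul] at e2
  have g1 : 0 < Gamma β := Gamma_pos_of_pos h0
  have g2 : 0 < Gamma (2 * β) := Gamma_pos_of_pos (by linarith)
  have g3 : 0 < Gamma (1 - β) := Gamma_pos_of_pos (by linarith)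
  rw [eq_div_iff hs.ne'] at e1
  rw [eq_div_iff (by positivity)] at e2
  unfold beta
  rw [show β + (1 - 2 * β) = 1 - β by ring, show β + β = 2 * β by ring]
  rw [mul_one_div, eq_div_iff hc.ne']
  generalize π * β = x at *
  field_simp
  refine mul_right_cancel₀ hs.ne' ?_
  linear_combination e2 - e1

lemma causalForm_le {μ : ℝ} (hμ0 : 0 < μ) (hμ1 : μ < 1) {T : ℝ} (hT : 0 < T)
    {f g : ℝ → ℝ} {C D : ℝ} (hf : AEStronglyMeasurable f) (hg : AEStronglyMeasurable g)
    (hfC : ∀ t, |f t| ≤ C * powWeight μ T t) (hgD : ∀ t, |g t| ≤ D * powWeight μ T t) :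
    causalForm μ f g ≤
      1 / cos (π * (μ / 2)) * √(causalForm μ f f) * √(causalForm μ g g) := by
  obtain ⟨β, rfl⟩ : ∃ β, μ = 2 * β := ⟨μ / 2, by ring⟩
  have h0 : 0 < β := by linarith
  have hm1 : Measurable (Function.uncurry fun x s : ℝ => posPow β (x - s)) := by
    unfold Function.uncurry
    fun_prop
  have hm2 : Measurable (Function.uncurry fun x s : ℝ => posPow β (s - x)) := by
    unfold Function.uncurry
    fun_prop
  have hn1 : ∀ x s : ℝ, 0 ≤ posPow β (x - s) := fun x s => posPow_nonneg _ _
  have hn2 : ∀ x s : ℝ, 0 ≤ posPow β (s - x) := fun x s => posPow_nonneg _ _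
  have hsym : ∀ {h : ℝ → ℝ} {E : ℝ}, AEStronglyMeasurable h →
      (∀ t, |h t| ≤ E * powWeight (2 * β) T t) →
      Integrable (fun p : ℝ × ℝ => h p.1 * h p.2 *
        (beta β (1 - 2 * β) * (posPow (2 * β) (p.2 - p.1) + posPow (2 * β) (p.1 - p.2)))) ∧
      ∫ p : ℝ × ℝ, h p.1 * h p.2 *
        (beta β (1 - 2 * β) * (posPow (2 * β) (p.2 - p.1) + posPow (2 * β) (p.1 - p.2))) =
        2 * beta β (1 - 2 * β) * causalForm (2 * β) h h := by
    intro h E hh hE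
    have i1 := integrable_causalForm hμ0 hμ1 hT hh hh hE hE
    have i2 : Integrable fun p : ℝ × ℝ =>
        h p.swap.1 * h p.swap.2 * posPow (2 * β) (p.swap.2 - p.swap.1) := i1.swap
    have e2 : ∫ p : ℝ × ℝ, h p.swap.1 * h p.swap.2 * posPow (2 * β) (p.swap.2 - p.swap.1) =
        causalForm (2 * β) h h :=
      integral_prod_swap (μ := volume) (ν := volume)
        (fun p : ℝ × ℝ => h p.1 * h p.2 * posPow (2 * β) (p.2 - p.1))
    have hfun : (fun p : ℝ × ℝ => h p.1 * h p.2 *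
        (beta β (1 - 2 * β) * (posPow (2 * β) (p.2 - p.1) + posPow (2 * β) (p.1 - p.2)))) =
        fun p => beta β (1 - 2 * β) * (h p.1 * h p.2 * posPow (2 * β) (p.2 - p.1) +
          h p.swap.1 * h p.swap.2 * posPow (2 * β) (p.swap.2 - p.swap.1)) := by
      ext p
      simp only [Prod.fst_swap, Prod.snd_swap]
      ring
    rw [hfun]
    refine ⟨(i1.add i2).const_mul _, ?_⟩
    rw [MeasureTheory.integral_const_mul, integral_add i1 i2, e2]
    unfold causalForm
    ring
  obtain ⟨pp1, pp2⟩ := integral_transform_mul_transform hm1 hm1 hn1 hn1 hf hf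
    (C := fun s t => beta β (1 - 2 * β) * (posPow (2 * β) (t - s) + posPow (2 * β) (s - t)))
    (ae_fst_ne_snd.mono fun p hp => hasCorr_posPow h0 hμ1 hp) (hsym hf hfC).1
  obtain ⟨mm1, mm2⟩ := integral_transform_mul_transform hm2 hm2 hn2 hn2 hg hg
    (C := fun s t => beta β (1 - 2 * β) * (posPow (2 * β) (t - s) + posPow (2 * β) (s - t)))
    (ae_fst_ne_snd.mono fun p hp => hasCorr_posPow_reflect h0 hμ1 hp) (hsym hg hgD).1
  have hpmi : (fun p : ℝ × ℝ => f p.1 * g p.2 * (beta β β * posPow (2 * β) (p.2 - p.1))) =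
      fun p => beta β β * (f p.1 * g p.2 * posPow (2 * β) (p.2 - p.1)) := by
    ext p
    ring
  obtain ⟨pm1, pm2⟩ := integral_transform_mul_transform hm1 hm2 hn1 hn2 hf hg
    (C := fun s t => beta β β * posPow (2 * β) (t - s))
    (ae_of_all _ fun p => by
      rw [two_mul]
      exact hasConv_posPow h0 h0 p.1 p.2)
    (by
      rw [hpmi]
      exact (integrable_causalForm hμ0 hμ1 hT hf hg hfC hgD).const_mul _)
  have cs := integral_mul_le_sqrt_mul_sqrt pp1 mm1 pm1
  simp only at pp2 mm2 pm2
  rw [pp2, mm2, pm2, hpmi, MeasureTheory.integral_const_mul, (hsym hf hfC).2, (hsym hg hgD).2,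
    two_mul_beta_div_beta h0 hμ1] at cs
  have hb : 0 < beta β β := beta_pos h0 h0
  have hc : 0 < cos (π * β) := cos_pos_of_mem_Ioo ⟨by nlinarith [pi_pos], by nlinarith [pi_pos]⟩
  have hk : 0 ≤ beta β β * (1 / cos (π * β)) := by positivity
  rw [sqrt_mul hk, sqrt_mul hk, mul_mul_mul_comm, mul_self_sqrt hk, mul_assoc] at cs
  rw [show 2 * β / 2 = β by ring, mul_assoc]
  exact le_of_mul_le_mul_left cs hb

lemma beta_comm (a b : ℝ) : beta a b = beta b a := by
  unfold beta
  rw [add_comm, mul_comm]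

lemma posPow_one_of_pos {r : ℝ} (hr : 0 < r) : posPow 1 r = 1 := by
  rw [posPow_of_pos 1 hr, sub_self, rpow_zero]

lemma integrable_posPow_mul {c : ℝ} (hc : 0 < c) {q : ℝ → ℝ} {M : ℝ}
    (hq : AEStronglyMeasurable q) (hqM : ∀ r, |q r| ≤ M * posPow 1 r) (t : ℝ) :
    Integrable fun r => posPow c (t - r) * q r := by
  refine ((hasConv_posPow one_pos hc 0 t).1.const_mul M).mono'
    (AEStronglyMeasurable.mul (Measurable.aestronglyMeasurable (by fun_prop)) hq)
    (ae_of_all _ fun r => ?_)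
  rw [norm_mul, norm_of_nonneg (posPow_nonneg _ _), norm_eq_abs, sub_zero, mul_comm, ← mul_assoc]
  exact mul_le_mul_of_nonneg_right (hqM r) (posPow_nonneg _ _)

lemma abs_integral_posPow_mul_le {c : ℝ} (hc : 0 < c) {q : ℝ → ℝ} {M : ℝ}
    (hqM : ∀ r, |q r| ≤ M * posPow 1 r) (t : ℝ) :
    |∫ r, posPow c (t - r) * q r| ≤ M * beta 1 c * posPow (1 + c) t := by
  have h := hasConv_posPow one_pos hc 0 t
  rw [sub_zero] at h
  rw [mul_assoc, ← h.2, ← MeasureTheory.integral_const_mul, ← norm_eq_abs]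
  refine norm_integral_le_of_norm_le (h.1.const_mul M) (ae_of_all _ fun r => ?_)
  rw [norm_mul, norm_of_nonneg (posPow_nonneg _ _), norm_eq_abs, sub_zero, mul_comm, ← mul_assoc]
  exact mul_le_mul_of_nonneg_right (hqM r) (posPow_nonneg _ _)

lemma integral_posPow_integral_posPow {a b : ℝ} (ha : 0 < a) (hb : 0 < b) {q : ℝ → ℝ} {M : ℝ}
    (hq : AEStronglyMeasurable q) (hqM : ∀ r, |q r| ≤ M * posPow 1 r) (t : ℝ) :
    Integrable (fun s => posPow b (t - s) * ∫ r, posPow a (s - r) * q r) ∧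
      ∫ s, posPow b (t - s) * ∫ r, posPow a (s - r) * q r =
        beta a b * ∫ r, posPow (a + b) (t - r) * q r := by
  have hm : AEStronglyMeasurable (fun z : ℝ × ℝ =>
      q z.1 * (posPow a (z.2 - z.1) * posPow b (t - z.2))) (volume.prod volume) :=
    hq.comp_fst.mul (Measurable.aestronglyMeasurable (by fun_prop))
  have hc := fun r => hasConv_posPow ha hb r t
  have hint : Integrable (fun z : ℝ × ℝ =>
      q z.1 * (posPow a (z.2 - z.1) * posPow b (t - z.2))) (volume.prod volume) := by
    rw [integrable_prod_iff hm]
    refine ⟨ae_of_all _ fun r => (hc r).1.const_mul (q r),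
      ((integrable_posPow_mul (add_pos ha hb) hq hqM t).norm.const_mul (beta a b)).congr
        (ae_of_all _ fun r => ?_)⟩
    simp_rw [norm_mul, norm_of_nonneg (posPow_nonneg _ _)]
    rw [MeasureTheory.integral_const_mul, (hc r).2]
    ring
  have hs : ∀ s, ∫ r, q r * (posPow a (s - r) * posPow b (t - s)) =
      posPow b (t - s) * ∫ r, posPow a (s - r) * q r := by
    intro s
    rw [← MeasureTheory.integral_const_mul]
    exact integral_congr_ae (ae_of_all _ fun r => by simp only; ring)
  constructor
  · exact hint.integral_prod_right.congr (ae_of_all _ hs)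
  · simp_rw [← hs]
    rw [← integral_integral_swap (f := fun r s => q r * (posPow a (s - r) * posPow b (t - s))) hint,
      ← MeasureTheory.integral_const_mul]
    refine integral_congr_ae (ae_of_all _ fun r => ?_)
    simp only
    rw [MeasureTheory.integral_const_mul, (hc r).2]
    ring

/-- Up to a constant, the fractional integral of order `a` of the derivative of a function with
initial value `c` and derivative `q`, the jump at `0` included. -/
noncomputable def fracPow (c : ℝ) (q : ℝ → ℝ) (a t : ℝ) : ℝ :=
  posPow a t * c + ∫ r, posPow a (t - r) * q r

lemma aestronglyMeasurable_fracPow (c : ℝ) {q : ℝ → ℝ} (hq : AEStronglyMeasurable q) (a : ℝ) :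
    AEStronglyMeasurable (fracPow c q a) := by
  have h : AEStronglyMeasurable (fun z : ℝ × ℝ => posPow a (z.1 - z.2) * q z.2)
      (volume.prod volume) :=
    AEStronglyMeasurable.mul (Measurable.aestronglyMeasurable (by fun_prop)) hq.comp_snd
  exact (Measurable.aestronglyMeasurable (by fun_prop)).add h.integral_prod_right'

lemma integral_posPow_fracPow {a b : ℝ} (ha : 0 < a) (hb : 0 < b) (c : ℝ) {q : ℝ → ℝ} {M : ℝ}
    (hq : AEStronglyMeasurable q) (hqM : ∀ r, |q r| ≤ M * posPow 1 r) (t : ℝ) :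
    Integrable (fun s => posPow b (t - s) * fracPow c q a s) ∧
      ∫ s, posPow b (t - s) * fracPow c q a s = beta a b * fracPow c q (a + b) t := by
  obtain ⟨i1, e1⟩ := hasConv_posPow ha hb 0 t
  obtain ⟨i2, e2⟩ := integral_posPow_integral_posPow ha hb hq hqM t
  have h : (fun s => posPow b (t - s) * fracPow c q a s) = fun s =>
      c * (posPow a (s - 0) * posPow b (t - s)) +
        posPow b (t - s) * ∫ r, posPow a (s - r) * q r := by
    ext s
    rw [fracPow, sub_zero]
    ring
  rw [h]
  refine ⟨(i1.const_mul c).add i2, ?_⟩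
  rw [integral_add (i1.const_mul c) i2, MeasureTheory.integral_const_mul, e1, e2, fracPow, sub_zero]
  ring

lemma fracPow_of_nonpos (c : ℝ) {q : ℝ → ℝ} {M : ℝ} (hqM : ∀ r, |q r| ≤ M * posPow 1 r) (a : ℝ)
    {t : ℝ} (ht : t ≤ 0) : fracPow c q a t = 0 := by
  have h : ∀ r, posPow a (t - r) * q r = 0 := by
    intro r
    rcases le_or_gt r 0 with hr | hr
    · have := hqM r
      rw [posPow_of_nonpos 1 hr, mul_zero] at this
      rw [abs_nonpos_iff.1 this, mul_zero]
    · rw [posPow_of_nonpos a (by linarith), zero_mul]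
  simp [fracPow, posPow_of_nonpos a ht, h]

lemma abs_fracPow_le (c : ℝ) {q : ℝ → ℝ} {M : ℝ} (hqM : ∀ r, |q r| ≤ M * posPow 1 r)
    {a T : ℝ} (ha : 0 < a) {t : ℝ} (ht : t ≤ T) (hM : 0 ≤ M) :
    |fracPow c q a t| ≤ (|c| + M * beta 1 a * T) * posPow a t := by
  rcases le_or_gt t 0 with h0 | h0
  · rw [fracPow_of_nonpos c hqM a h0, posPow_of_nonpos a h0]
    simp
  · have h1 := abs_integral_posPow_mul_le ha hqM t
    have hb := beta_pos one_pos ha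
    have h2 : posPow (1 + a) t = t * posPow a t := by
      rw [posPow_of_pos _ h0, posPow_of_pos _ h0, show 1 + a - 1 = 1 + (a - 1) by ring,
        rpow_add h0, rpow_one]
    have h3 : posPow (1 + a) t ≤ T * posPow a t :=
      h2 ▸ mul_le_mul_of_nonneg_right ht (posPow_nonneg _ _)
    have h4 : M * beta 1 a * posPow (1 + a) t ≤ M * beta 1 a * (T * posPow a t) :=
      mul_le_mul_of_nonneg_left h3 (by positivity)
    refine (abs_add_le _ _).trans ?_
    rw [abs_mul, abs_of_nonneg (posPow_nonneg _ _)]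
    linarith

lemma fracPow_one {T : ℝ} {v v' : ℝ → ℝ}
    (hv : ∀ s ∈ Icc (0:ℝ) T, HasDerivAt v (v' s) s) (hv' : ContinuousOn v' (Icc 0 T))
    {t : ℝ} (ht : t ∈ Ioc 0 T) : fracPow (v 0) ((Ioc 0 T).indicator v') 1 t = v t := by
  have hsub : Icc 0 t ⊆ Icc 0 T := Icc_subset_Icc_right ht.2
  have hftc : ∫ r in (0:ℝ)..t, v' r = v t - v 0 := by
    refine intervalIntegral.integral_eq_sub_of_hasDerivAt (fun s hs => ?_) ?_
    · rw [uIcc_of_le ht.1.le] at hs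
      exact hv s (hsub hs)
    · refine ContinuousOn.intervalIntegrable ?_
      rw [uIcc_of_le ht.1.le]
      exact hv'.mono hsub
  have hind : (fun r => posPow 1 (t - r) * (Ioc 0 T).indicator v' r) =
      (Ioo 0 t).indicator v' := by
    ext r
    by_cases hr : r ∈ Ioo 0 t
    · rw [indicator_of_mem hr, indicator_of_mem (show r ∈ Ioc 0 T from ⟨hr.1, hr.2.le.trans ht.2⟩),
        posPow_one_of_pos (by linarith [hr.2]), one_mul]
    · rw [indicator_of_notMem hr]
      rcases le_or_gt r 0 with h | h
      · rw [indicator_of_notMem (fun h' => h.not_gt h'.1), mul_zero]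
      · have : t ≤ r := not_lt.1 fun h' => hr ⟨h, h'⟩
        rw [posPow_of_nonpos 1 (by linarith), zero_mul]
  rw [fracPow, hind, posPow_one_of_pos ht.1, MeasureTheory.integral_indicator measurableSet_Ioo,
    ← integral_Ioc_eq_integral_Ioo, ← intervalIntegral.integral_of_le ht.1.le, hftc]
  ring

lemma intervalIntegral_rpow_mul {a T : ℝ} (ha : a ≠ 1) (f : ℝ → ℝ) {t : ℝ} (ht0 : 0 ≤ t)
    (htT : t ≤ T) :
    ∫ s in (0:ℝ)..t, (t - s) ^ (a - 1) * f s =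
      ∫ s, posPow a (t - s) * (Ioc 0 T).indicator f s := by
  rw [intervalIntegral.integral_of_le ht0, ← MeasureTheory.integral_indicator measurableSet_Ioc]
  refine integral_congr_ae (ae_of_all _ fun s => ?_)
  simp only
  by_cases hs : s ∈ Ioc 0 t
  · rw [indicator_of_mem hs, indicator_of_mem (show s ∈ Ioc 0 T from ⟨hs.1, hs.2.trans htT⟩)]
    rcases hs.2.lt_or_eq with h | h
    · rw [posPow_of_pos a (by linarith)]
    · rw [h, sub_self, posPow_of_nonpos a le_rfl, zero_rpow (sub_ne_zero.2 ha)]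
  · rw [indicator_of_notMem hs]
    rcases le_or_gt s 0 with h | h
    · rw [indicator_of_notMem (fun h' => h.not_gt h'.1), mul_zero]
    · have : t ≤ s := not_lt.1 fun h' => hs ⟨h, h'.le⟩
      rw [posPow_of_nonpos a (by linarith), zero_mul]

lemma integral_posPow_indicator {a T : ℝ} {f : ℝ → ℝ} (hf : ∀ s ≤ 0, f s = 0) {t : ℝ}
    (ht : t ≤ T) :
    ∫ s, posPow a (t - s) * (Ioc 0 T).indicator f s = ∫ s, posPow a (t - s) * f s := by
  refine integral_congr_ae (ae_of_all _ fun s => ?_)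
  simp only
  by_cases hs : s ∈ Ioc 0 T
  · rw [indicator_of_mem hs]
  · rw [indicator_of_notMem hs]
    rcases le_or_gt s 0 with h | h
    · rw [hf s h]
    · have : T < s := not_le.1 fun h' => hs ⟨h, h'⟩
      rw [posPow_of_nonpos a (by linarith), zero_mul, zero_mul]

lemma causalForm_indicator {μ T : ℝ} (hT : 0 ≤ T) {f g : ℝ → ℝ}
    (h : Integrable fun p : ℝ × ℝ =>
      f p.1 * (Ioc 0 T).indicator g p.2 * posPow μ (p.2 - p.1)) :
    causalForm μ f ((Ioc 0 T).indicator g) =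
      ∫ t in (0:ℝ)..T, g t * ∫ s, posPow μ (t - s) * f s := by
  rw [causalForm, Measure.volume_eq_prod, integral_prod_symm _ h,
    intervalIntegral.integral_of_le hT, ← MeasureTheory.integral_indicator measurableSet_Ioc]
  refine integral_congr_ae (ae_of_all _ fun t => ?_)
  simp only
  by_cases ht : t ∈ Ioc 0 T
  · rw [indicator_of_mem ht, indicator_of_mem ht, ← MeasureTheory.integral_const_mul]
    exact integral_congr_ae (ae_of_all _ fun s => by simp only; ring)
  · simp [indicator_of_notMem ht]

/-- For `C¹` data, the primitive of the fractional derivative kernel is the fractional integral. -/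
lemma intervalIntegral_fracPow {T a : ℝ} (ha0 : 0 < a) (ha1 : a ≠ 1) {v v' : ℝ → ℝ} {M : ℝ}
    (hv : ∀ s ∈ Icc (0:ℝ) T, HasDerivAt v (v' s) s) (hv' : ContinuousOn v' (Icc 0 T))
    (hq : AEStronglyMeasurable ((Ioc 0 T).indicator v'))
    (hqM : ∀ r, |(Ioc 0 T).indicator v' r| ≤ M * posPow 1 r) {t : ℝ} (ht : t ∈ Ioc 0 T) :
    ∫ s in (0:ℝ)..t, (t - s) ^ (a - 1) * v s =
      ∫ s in (0:ℝ)..t, fracPow (v 0) ((Ioc 0 T).indicator v') a s := by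
  set q := (Ioc 0 T).indicator v'
  have h1 : (Ioc 0 T).indicator v = (Ioc 0 T).indicator (fracPow (v 0) q 1) :=
    indicator_congr fun s hs => (fracPow_one hv hv' hs).symm
  have h2 : (Ioo 0 t).indicator (fracPow (v 0) q a) =
      fun s => posPow 1 (t - s) * fracPow (v 0) q a s := by
    ext s
    by_cases hs : s ∈ Ioo 0 t
    · rw [indicator_of_mem hs, posPow_one_of_pos (by linarith [hs.2]), one_mul]
    · rw [indicator_of_notMem hs]
      rcases le_or_gt s 0 with h | h
      · rw [fracPow_of_nonpos _ hqM _ h, mul_zero]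
      · have : t ≤ s := not_lt.1 fun h' => hs ⟨h, h'⟩
        rw [posPow_of_nonpos 1 (by linarith), zero_mul]
  rw [intervalIntegral_rpow_mul ha1 v ht.1.le ht.2, h1,
    integral_posPow_indicator (fun s hs => fracPow_of_nonpos _ hqM _ hs) ht.2,
    (integral_posPow_fracPow one_pos ha0 _ hq hqM t).2,
    intervalIntegral.integral_of_le ht.1.le, integral_Ioc_eq_integral_Ioo,
    ← MeasureTheory.integral_indicator measurableSet_Ioo, h2, (integral_posPow_fracPow ha0 one_pos _ hq hqM t).2,
    beta_comm, add_comm]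

lemma exists_abs_indicator_le {T : ℝ} {f : ℝ → ℝ} (hf : ContinuousOn f (Icc 0 T)) :
    ∃ M, 0 ≤ M ∧ ∀ r, |(Ioc 0 T).indicator f r| ≤ M * posPow 1 r := by
  obtain ⟨M, hM⟩ := isCompact_Icc.exists_bound_of_continuousOn hf
  refine ⟨|M|, abs_nonneg M, fun r => ?_⟩
  by_cases hr : r ∈ Ioc 0 T
  · rw [indicator_of_mem hr, posPow_one_of_pos hr.1, mul_one]
    exact (hM r (Ioc_subset_Icc_self hr)).trans (le_abs_self M)
  · rw [indicator_of_notMem hr, abs_zero]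
    exact mul_nonneg (abs_nonneg M) (posPow_nonneg _ _)

lemma aestronglyMeasurable_indicator_Ioc {T : ℝ} {f : ℝ → ℝ} (hf : ContinuousOn f (Icc 0 T)) :
    AEStronglyMeasurable ((Ioc 0 T).indicator f) :=
  (aestronglyMeasurable_indicator_iff measurableSet_Ioc).2
    ((hf.mono Ioc_subset_Icc_self).aestronglyMeasurable measurableSet_Ioc)

lemma abs_indicator_le_powWeight {μ T M : ℝ} (hμ0 : 0 ≤ μ) {f : ℝ → ℝ} (hM : 0 ≤ M)
    (hfM : ∀ r, |(Ioc 0 T).indicator f r| ≤ M * posPow 1 r) (t : ℝ) :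
    |(Ioc 0 T).indicator f t| ≤ M * T ^ μ * powWeight μ T t := by
  by_cases ht : t ∈ Ioc 0 T
  · refine (hfM t).trans ?_
    have hT : 0 < T := ht.1.trans_le ht.2
    rw [powWeight, indicator_of_mem ht, posPow_one_of_pos ht.1, posPow_of_pos _ ht.1, mul_assoc,
      show 1 - μ - 1 = -μ by ring, rpow_neg ht.1.le, ← div_eq_mul_inv]
    refine mul_le_mul_of_nonneg_left ?_ hM
    rw [one_le_div (rpow_pos_of_pos ht.1 _)]
    exact rpow_le_rpow ht.1.le ht.2 hμ0
  · simp [powWeight, indicator_of_notMem ht]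

lemma ae_deriv_fracIntegral {T a : ℝ} (hT : 0 < T) (ha0 : 0 < a) (ha1 : a ≠ 1)
    {v v' : ℝ → ℝ} {M : ℝ}
    (hv : ∀ s ∈ Icc (0:ℝ) T, HasDerivAt v (v' s) s) (hv' : ContinuousOn v' (Icc 0 T))
    (hq : AEStronglyMeasurable ((Ioc 0 T).indicator v'))
    (hqM : ∀ r, |(Ioc 0 T).indicator v' r| ≤ M * posPow 1 r) :
    ∀ᵐ t : ℝ, t ∈ Ioc 0 T →
      deriv (fun τ => ∫ s in (0:ℝ)..τ, (τ - s) ^ (a - 1) / Gamma a * v s) t =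
        fracPow (v 0) ((Ioc 0 T).indicator v') a t / Gamma a := by
  set q := (Ioc 0 T).indicator v'
  have hint : IntervalIntegrable (fracPow (v 0) q a) volume 0 T := by
    have h := (integral_posPow_fracPow ha0 one_pos (v 0) hq hqM T).1
    rw [intervalIntegrable_iff_integrableOn_Ioo_of_le hT.le]
    refine h.integrableOn.congr_fun (fun s hs => ?_) measurableSet_Ioo
    simp only
    rw [posPow_one_of_pos (by linarith [hs.2]), one_mul]
  have hne : ∀ᵐ t : ℝ, t ≠ T := compl_mem_ae_iff.2 (measure_singleton T)
  filter_upwards [hint.ae_hasDerivAt_integral, hne] with t h htT ht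
  have ht' : t ∈ Ioo 0 T := ⟨ht.1, ht.2.lt_of_ne htT⟩
  have hd := (h (by rw [uIcc_of_le hT.le]; exact Ioc_subset_Icc_self ht) 0
    (by rw [uIcc_of_le hT.le]; exact ⟨le_rfl, hT.le⟩)).div_const (Gamma a)
  refine (hd.congr_of_eventuallyEq ?_).deriv
  filter_upwards [isOpen_Ioo.mem_nhds ht'] with τ hτ
  rw [← intervalIntegral_fracPow ha0 ha1 hv hv' hq hqM (Ioo_subset_Ioc_self hτ),
    ← intervalIntegral.integral_div]
  exact intervalIntegral.integral_congr fun s _ => by ring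

theorem integral_mul_le_fractional {μ T : ℝ} (hμ0 : 0 < μ) (hμ1 : μ < 1) (hT : 0 < T)
    {v v' w : ℝ → ℝ}
    (hv : ∀ s ∈ Icc (0:ℝ) T, HasDerivAt v (v' s) s) (hv' : ContinuousOn v' (Icc 0 T))
    (hw : ContinuousOn w (Icc 0 T)) :
    ∫ t in (0:ℝ)..T, v t * w t ≤ 1 / cos (π * (μ / 2)) *
      √(∫ t in (0:ℝ)..T, v t * deriv (fun τ => ∫ s in (0:ℝ)..τ,
        (τ - s) ^ (1 - μ - 1) / Gamma (1 - μ) * v s) t) *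
      √(∫ t in (0:ℝ)..T, w t * ∫ s in (0:ℝ)..t, (t - s) ^ (μ - 1) / Gamma μ * w s) := by
  obtain ⟨M, hM, hqM⟩ := exists_abs_indicator_le hv'
  obtain ⟨N, hN, hwN⟩ := exists_abs_indicator_le hw
  have hq := aestronglyMeasurable_indicator_Ioc hv'
  have hWm := aestronglyMeasurable_indicator_Ioc hw
  have hWN := abs_indicator_le_powWeight hμ0.le hN hwN
  have ha : 0 < 1 - μ := by linarith
  set q := (Ioc 0 T).indicator v'
  set Y := fracPow (v 0) q (1 - μ) 
  set U := (Ioc 0 T).indicator Y with hU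
  set W := (Ioc 0 T).indicator w with hW
  set c := |v 0| + M * beta 1 (1 - μ) * T
  have hUm : AEStronglyMeasurable U :=
    (aestronglyMeasurable_fracPow (v 0) hq (1 - μ)).indicator measurableSet_Ioc
  have hUc : ∀ t, |U t| ≤ c * powWeight μ T t := by
    intro t
    by_cases ht : t ∈ Ioc 0 T
    · rw [hU, powWeight, indicator_of_mem ht, indicator_of_mem ht]
      exact abs_fracPow_le (v 0) hqM ha ht.2 hM
    · simp [hU, powWeight, indicator_of_notMem ht]
  have g1 : 0 < Gamma (1 - μ) := Gamma_pos_of_pos ha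
  have g2 : 0 < Gamma μ := Gamma_pos_of_pos hμ0
  have hinv : ∀ t ∈ Ioc 0 T, ∫ s, posPow μ (t - s) * U s = Gamma (1 - μ) * Gamma μ * v t := by
    intro t ht
    rw [hU, integral_posPow_indicator (fun s hs => fracPow_of_nonpos _ hqM _ hs) ht.2,
      (integral_posPow_fracPow ha hμ0 (v 0) hq hqM t).2, sub_add_cancel, fracPow_one hv hv' ht,
      beta, sub_add_cancel, Gamma_one, div_one]
  have eUW : causalForm μ U W = Gamma (1 - μ) * Gamma μ * ∫ t in (0:ℝ)..T, v t * w t := by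
    rw [hW, causalForm_indicator hT.le (integrable_causalForm hμ0 hμ1 hT hUm hWm hUc hWN),
      ← intervalIntegral.integral_const_mul]
    refine intervalIntegral.integral_congr_ae (ae_of_all _ fun t ht => ?_)
    rw [uIoc_of_le hT.le] at ht
    rw [hinv t ht]
    ring
  have eUU : causalForm μ U U = Gamma (1 - μ) ^ 2 * Gamma μ *
      ∫ t in (0:ℝ)..T, v t * deriv (fun τ => ∫ s in (0:ℝ)..τ,
        (τ - s) ^ (1 - μ - 1) / Gamma (1 - μ) * v s) t := by
    rw [hU, causalForm_indicator hT.le (integrable_causalForm hμ0 hμ1 hT hUm hUm hUc hUc),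
      ← intervalIntegral.integral_const_mul]
    refine intervalIntegral.integral_congr_ae ?_
    filter_upwards [ae_deriv_fracIntegral hT ha (by linarith : 1 - μ ≠ 1) hv hv' hq hqM]
      with t h ht
    rw [uIoc_of_le hT.le] at ht
    rw [h ht, hinv t ht]
    field_simp
    exact mul_comm _ _
  have eWW : causalForm μ W W = Gamma μ *
      ∫ t in (0:ℝ)..T, w t * ∫ s in (0:ℝ)..t, (t - s) ^ (μ - 1) / Gamma μ * w s := by
    rw [hW, causalForm_indicator hT.le (integrable_causalForm hμ0 hμ1 hT hWm hWm hWN hWN),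
      ← intervalIntegral.integral_const_mul]
    refine intervalIntegral.integral_congr_ae (ae_of_all _ fun t ht => ?_)
    rw [uIoc_of_le hT.le] at ht
    rw [← intervalIntegral_rpow_mul hμ1.ne w ht.1.le ht.2, mul_left_comm,
      ← intervalIntegral.integral_const_mul (Gamma μ)]
    congr 1
    refine intervalIntegral.integral_congr fun s _ => ?_
    field_simp
  have key := causalForm_le hμ0 hμ1 hT hUm hWm hUc hWN
  rw [eUW, eUU, eWW, mul_assoc (Gamma (1 - μ) ^ 2), sqrt_mul (by positivity), sqrt_mul g2.le,
    sqrt_mul g2.le, sqrt_sq g1.le] at key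
  refine le_of_mul_le_mul_left (key.trans_eq ?_) (mul_pos g1 g2)
  have hs : √(Gamma μ) * √(Gamma μ) = Gamma μ := mul_self_sqrt g2.le
  generalize √(Gamma μ) = x, √(∫ t in (0:ℝ)..T, v t * _) = y,
    √(∫ t in (0:ℝ)..T, w t * _) = z at *
  linear_combination (1 / cos (π * (μ / 2)) * Gamma (1 - μ) * y * z) * hs

end

/-- For `-1 < α < 0`, `T > 0`, `d_α = 1/cos(απ/2)` and all `v, w ∈ C¹([0,T])`,
`∫₀ᵀ v w ≤ d_α (∫₀ᵀ v 𝓑_α v)^{1/2} (∫₀ᵀ w 𝓘_{-α} w)^{1/2}`. -/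
theorem stmt_8 (α T : ℝ) (hα₁ : -1 < α) (hα₂ : α < 0) (hT : 0 < T)
    (v v' w w' : ℝ → ℝ)
    (hv : ∀ s ∈ Set.Icc (0:ℝ) T, HasDerivAt v (v' s) s)
    (hv' : ContinuousOn v' (Set.Icc 0 T))
    (hw : ∀ s ∈ Set.Icc (0:ℝ) T, HasDerivAt w (w' s) s)
    (hw' : ContinuousOn w' (Set.Icc 0 T)) :
    ∫ t in (0:ℝ)..T, v t * w t
      ≤ (1 / Real.cos (α * Real.pi / 2)) *
          Real.sqrt (∫ t in (0:ℝ)..T,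
            v t * deriv (fun τ => ∫ s in (0:ℝ)..τ, ((τ - s) ^ α / Real.Gamma (α + 1)) * v s) t) *
          Real.sqrt (∫ t in (0:ℝ)..T,
            w t * ∫ s in (0:ℝ)..t, ((t - s) ^ (-α - 1) / Real.Gamma (-α)) * w s) := by
  have h := integral_mul_le_fractional (μ := -α) (by linarith) (by linarith) hT hv hv'
    (fun s hs => (hw s hs).continuousAt.continuousWithinAt)
  rwa [show 1 - -α - 1 = α by ring, show 1 - -α = α + 1 by ring,
    show π * (-α / 2) = -(α * π / 2) by ring, cos_neg] at h
end

section
/- Let $-1<\alpha<0$, $T>0$, and set $d_\alpha = 1/\cos(\alpha\pi/2)$. Then for all $v,w\in \mathcal C^1([0,T])$, $\int_0^T v(t)\,\mathcal B_\alpha w(t)\,dt \;\le\; d_\alpha \left(\int_0^T v\,\mathcal B_\alpha v\,dt\right)^{1/2} \left(\int_0^T w\,\mathcal B_\alpha w\,dt\right)^{1/2}$. -/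
open Real intervalIntegral Set
open MeasureTheory Filter Topology FourierTransform

lemma integrableOn_rpow_mul_exp_neg_mul {b r : ℝ} (hb : -1 < b) (hr : 0 < r) :
    IntegrableOn (fun t : ℝ => t ^ b * Real.exp (-r * t)) (Ioi 0) := by
  simpa using integrableOn_rpow_mul_exp_neg_mul_rpow hb one_pos hr

lemma norm_rpow_mul_cexp (b : ℝ) (z : ℂ) {t : ℝ} (ht : 0 < t) :
    ‖((t ^ b : ℝ) : ℂ) * Complex.exp (-z * t)‖ = t ^ b * Real.exp (-z.re * t) := by
  rw [norm_mul, Complex.norm_real, Complex.norm_exp, Real.norm_of_nonneg (by positivity)]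
  simp

lemma aestronglyMeasurable_rpow_mul_cexp (b : ℝ) (z : ℂ) (μ : Measure ℝ) :
    AEStronglyMeasurable (fun t : ℝ => ((t ^ b : ℝ) : ℂ) * Complex.exp (-z * t)) μ := by
  refine Measurable.aestronglyMeasurable ?_
  fun_prop

lemma integrableOn_rpow_mul_cexp {b : ℝ} (hb : -1 < b) {z : ℂ} (hz : 0 < z.re) :
    IntegrableOn (fun t : ℝ => ((t ^ b : ℝ) : ℂ) * Complex.exp (-z * t)) (Ioi 0) := by
  refine (integrableOn_rpow_mul_exp_neg_mul hb hz).mono'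
    (aestronglyMeasurable_rpow_mul_cexp b z _) ?_
  filter_upwards [ae_restrict_mem measurableSet_Ioi] with t ht
  exact (norm_rpow_mul_cexp b z ht).le

lemma differentiableAt_integral_rpow_mul_cexp {b : ℝ} (hb : -1 < b) {z : ℂ} (hz : 0 < z.re) :
    DifferentiableAt ℂ
      (fun z : ℂ => ∫ t in Ioi (0 : ℝ), ((t ^ b : ℝ) : ℂ) * Complex.exp (-z * t)) z := by
  have hnhds : {w : ℂ | z.re / 2 < w.re} ∈ 𝓝 z :=
    (isOpen_lt continuous_const Complex.continuous_re).mem_nhds (by simpa using hz)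
  refine (hasDerivAt_integral_of_dominated_loc_of_deriv_le
    (F' := fun w t => -(((t ^ (b + 1) : ℝ) : ℂ) * Complex.exp (-w * t)))
    (bound := fun t => t ^ (b + 1) * Real.exp (-(z.re / 2) * t)) hnhds
    (Eventually.of_forall fun w => aestronglyMeasurable_rpow_mul_cexp b w _)
    (integrableOn_rpow_mul_cexp hb hz)
    (aestronglyMeasurable_rpow_mul_cexp (b + 1) z _).neg ?_
    (integrableOn_rpow_mul_exp_neg_mul (by linarith) (by linarith)) ?_).2.differentiableAt
  · filter_upwards [ae_restrict_mem measurableSet_Ioi] with t ht w hw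
    have ht' : (0 : ℝ) < t := ht
    have hw' : z.re / 2 < w.re := hw
    rw [norm_neg, norm_rpow_mul_cexp _ _ ht]
    gcongr
  · filter_upwards [ae_restrict_mem measurableSet_Ioi] with t ht w _
    have ht' : (0 : ℝ) < t := ht
    have h := (((hasDerivAt_id w).neg.mul_const (t : ℂ)).cexp).const_mul ((t ^ b : ℝ) : ℂ)
    convert! h using 1
    rw [Real.rpow_add_one ht'.ne']
    push_cast
    simp
    ring

/-- The Gamma integral `∫₀^∞ t ^ b e^{-zt} dt` on the right half plane. -/
lemma integral_rpow_mul_cexp {b : ℝ} (hb : -1 < b) {z : ℂ} (hz : 0 < z.re) :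
    ∫ t in Ioi (0 : ℝ), ((t ^ b : ℝ) : ℂ) * Complex.exp (-z * t)
      = z ^ (-((b + 1 : ℝ) : ℂ)) * (Real.Gamma (b + 1) : ℂ) := by
  have hopen : IsOpen {w : ℂ | 0 < w.re} := isOpen_lt continuous_const Complex.continuous_re
  have hf : AnalyticOnNhd ℂ
      (fun z : ℂ => ∫ t in Ioi (0 : ℝ), ((t ^ b : ℝ) : ℂ) * Complex.exp (-z * t))
      {w : ℂ | 0 < w.re} :=
    DifferentiableOn.analyticOnNhd
      (fun w hw => (differentiableAt_integral_rpow_mul_cexp hb hw).differentiableWithinAt) hopen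
  have hg : AnalyticOnNhd ℂ
      (fun z : ℂ => z ^ (-((b + 1 : ℝ) : ℂ)) * (Real.Gamma (b + 1) : ℂ))
      {w : ℂ | 0 < w.re} := by
    refine DifferentiableOn.analyticOnNhd (fun w hw => ?_) hopen
    refine DifferentiableAt.differentiableWithinAt ?_
    exact (differentiableAt_id.cpow_const (Or.inl hw)).mul_const _
  have hreal : ∀ r : ℝ, 0 < r →
      ∫ t in Ioi (0 : ℝ), ((t ^ b : ℝ) : ℂ) * Complex.exp (-(r : ℂ) * t)
      = (r : ℂ) ^ (-((b + 1 : ℝ) : ℂ)) * (Real.Gamma (b + 1) : ℂ) := by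
    intro r hr
    rw [← Complex.ofReal_neg (b + 1), ← Complex.ofReal_cpow hr.le, ← Complex.ofReal_mul,
      Real.rpow_neg hr.le, ← Real.inv_rpow hr.le, ← one_div,
      ← Real.integral_rpow_mul_exp_neg_mul_Ioi (by linarith) hr, ← integral_complex_ofReal]
    refine setIntegral_congr_fun measurableSet_Ioi fun t _ => ?_
    simp
  refine hf.eqOn_of_preconnected_of_frequently_eq hg
    (convex_halfSpace_re_gt 0).isPreconnected (z₀ := 1) (by simp) ?_ hz
  have htend : Tendsto (fun n : ℕ => (((1 + 1 / ((n : ℝ) + 1) : ℝ)) : ℂ)) atTop (𝓝[≠] 1) := by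
    refine tendsto_nhdsWithin_iff.2 ⟨?_, Eventually.of_forall fun n => ?_⟩
    · have h : Tendsto (fun n : ℕ => (1 + 1 / ((n : ℝ) + 1) : ℝ)) atTop (𝓝 (1 + 0)) :=
        tendsto_one_div_add_atTop_nhds_zero_nat.const_add 1
      have := (Complex.continuous_ofReal.tendsto _).comp h
      simpa [Function.comp_def] using this
    · have h : (1 + 1 / ((n : ℝ) + 1) : ℝ) ≠ 1 := by
        have : (0 : ℝ) < 1 / ((n : ℝ) + 1) := by positivity
        linarith
      exact fun h' => h (Complex.ofReal_eq_one.1 h')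
  exact htend.frequently (Eventually.frequently <| Eventually.of_forall fun n =>
    hreal _ (by positivity))

/-- The parametrisation `y ↦ ε + 2πiy` of a vertical line. -/
noncomputable def verticalLine (ε y : ℝ) : ℂ := ε + 2 * π * y * Complex.I

@[simp] lemma verticalLine_re (ε y : ℝ) : (verticalLine ε y).re = ε := by
  simp [verticalLine]

@[simp] lemma verticalLine_im (ε y : ℝ) : (verticalLine ε y).im = 2 * π * y := by
  simp [verticalLine]

lemma continuous_verticalLine (ε : ℝ) : Continuous (verticalLine ε) := by
  unfold verticalLine; fun_prop

lemma verticalLine_ne_zero {ε : ℝ} (hε : 0 < ε) (y : ℝ) : verticalLine ε y ≠ 0 := by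
  intro h
  have := congrArg Complex.re h
  simp at this
  exact hε.ne' this

lemma continuous_verticalLine_cpow {ε : ℝ} (hε : 0 < ε) (c : ℂ) :
    Continuous fun y => verticalLine ε y ^ c :=
  (continuous_verticalLine ε).cpow continuous_const fun y => Or.inl (by simpa using hε)

lemma norm_verticalLine_cpow {ε : ℝ} (hε : 0 < ε) (y r : ℝ) :
    ‖verticalLine ε y ^ (r : ℂ)‖ = ‖verticalLine ε y‖ ^ r := by
  rw [Complex.norm_cpow_of_ne_zero (verticalLine_ne_zero hε y)]
  simp

lemma integrable_norm_verticalLine_rpow {ε r : ℝ} (hε : 0 < ε) (hr : r < -1) :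
    Integrable fun y => ‖verticalLine ε y‖ ^ r := by
  have hc : 0 < min ε 1 / 2 := by positivity
  have hcont : Continuous fun y => ‖verticalLine ε y‖ ^ r :=
    (continuous_verticalLine ε).norm.rpow_const fun y =>
      Or.inl (norm_ne_zero_iff.2 (verticalLine_ne_zero hε y))
  have hint : Integrable fun y : ℝ => (1 + ‖y‖) ^ (-(-r)) :=
    integrable_one_add_norm (by simpa using by linarith)
  refine (hint.const_mul ((min ε 1 / 2) ^ r)).mono' hcont.aestronglyMeasurable
    (Eventually.of_forall fun y => ?_)
  have h1 : ε ≤ ‖verticalLine ε y‖ := by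
    simpa using (le_abs_self _).trans (Complex.abs_re_le_norm (verticalLine ε y))
  have h2 : |y| ≤ ‖verticalLine ε y‖ := by
    have := Complex.abs_im_le_norm (verticalLine ε y)
    rw [verticalLine_im, abs_mul, abs_of_pos (by positivity)] at this
    nlinarith [abs_nonneg y, Real.pi_gt_three]
  have h3 : min ε 1 / 2 * (1 + ‖y‖) ≤ ‖verticalLine ε y‖ := by
    rw [Real.norm_eq_abs]
    nlinarith [min_le_left ε 1, min_le_right ε 1, abs_nonneg y]
  rw [Real.norm_of_nonneg (by positivity), neg_neg, ← Real.mul_rpow hc.le (by positivity)]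
  exact Real.rpow_le_rpow_of_nonpos (by positivity) h3 (by linarith)

lemma integrable_of_norm_le_verticalLine {ε r C : ℝ} (hε : 0 < ε) (hr : r < -1) {g : ℝ → ℂ}
    (hg : Continuous g) (hle : ∀ y, ‖g y‖ ≤ C * ‖verticalLine ε y‖ ^ r) : Integrable g :=
  ((integrable_norm_verticalLine_rpow hε hr).const_mul C).mono' hg.aestronglyMeasurable
    (Eventually.of_forall hle)

/-- Inverse Laplace transform of a power: the Bromwich integral of `z ^ (-(b + 1))`. -/
lemma integral_verticalLine_cpow_mul_cexp {b ε : ℝ} (hb : 0 < b) (hε : 0 < ε) (t : ℝ) :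
    ∫ y, verticalLine ε y ^ (-((b + 1 : ℝ) : ℂ)) * Complex.exp (verticalLine ε y * t)
      = ((max t 0 ^ b / Real.Gamma (b + 1) : ℝ) : ℂ) := by
  have hΓ : (Real.Gamma (b + 1) : ℂ) ≠ 0 :=
    Complex.ofReal_ne_zero.2 (Real.Gamma_pos_of_pos (by linarith)).ne'
  set φ : ℝ → ℂ := fun t => ((max t 0 ^ b : ℝ) : ℂ) * Complex.exp (-(ε : ℂ) * t) with hφ
  have hφc : Continuous φ := by
    have : Continuous fun t : ℝ => max t 0 ^ b :=
      (continuous_id.max continuous_const).rpow_const fun _ => Or.inr hb.le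
    fun_prop
  have hφ0 : ∀ t ∉ Ioi (0 : ℝ), φ t = 0 := by
    intro t ht
    simp only [mem_Ioi, not_lt] at ht
    simp [hφ, max_eq_right ht, Real.zero_rpow hb.ne']
  have hφpos : ∀ t ∈ Ioi (0 : ℝ), φ t = ((t ^ b : ℝ) : ℂ) * Complex.exp (-(ε : ℂ) * t) := by
    intro t ht
    simp only [hφ, max_eq_left (le_of_lt (mem_Ioi.1 ht))]
  have hφi : Integrable φ := by
    rw [← integrableOn_iff_integrable_of_support_subset (s := Ioi 0)]
    · exact (integrableOn_rpow_mul_cexp (b := b) (z := ε) (by linarith) (by simpa)).congr_fun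
        (fun t ht => (hφpos t ht).symm) measurableSet_Ioi
    · intro t ht
      by_contra h
      exact ht (hφ0 t h)
  have hF : 𝓕 φ = fun y =>
      verticalLine ε y ^ (-((b + 1 : ℝ) : ℂ)) * (Real.Gamma (b + 1) : ℂ) := by
    ext y
    rw [Real.fourier_real_eq_integral_exp_smul,
      ← integral_rpow_mul_cexp (by linarith) (by simpa using hε),
      ← setIntegral_eq_integral_of_forall_compl_eq_zero (s := Ioi 0)]
    · refine setIntegral_congr_fun measurableSet_Ioi fun t ht => ?_
      simp only [hφpos t ht, smul_eq_mul]
      rw [mul_left_comm, ← Complex.exp_add, verticalLine]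
      congr 2
      push_cast
      ring
    · intro t ht
      simp [hφ0 t ht]
  have hFi : Integrable (𝓕 φ) := by
    rw [hF]
    refine integrable_of_norm_le_verticalLine (r := -(b + 1)) (C := ‖(Real.Gamma (b + 1) : ℂ)‖) hε
      (by linarith) ((continuous_verticalLine_cpow hε _).mul continuous_const) fun y => ?_
    rw [norm_mul, ← Complex.ofReal_neg, norm_verticalLine_cpow hε, mul_comm]
  have hinv := congrFun (hφc.fourierInv_fourier_eq hφi hFi) t
  rw [Real.fourierInv_eq', hF] at hinv
  have hexp : Complex.exp (-(ε : ℂ) * t) ≠ 0 := Complex.exp_ne_zero _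
  have hkey : (∫ y, verticalLine ε y ^ (-((b + 1 : ℝ) : ℂ)) * Complex.exp (verticalLine ε y * t))
      * (Real.Gamma (b + 1) * Complex.exp (-(ε : ℂ) * t)) = φ t := by
    rw [← hinv, ← MeasureTheory.integral_mul_const]
    congr 1
    ext y
    have : Complex.exp (verticalLine ε y * t) * Complex.exp (-(ε : ℂ) * t)
        = Complex.exp (↑(2 * π * inner ℝ y t) * Complex.I) := by
      rw [← Complex.exp_add, verticalLine]
      congr 1
      simp
      ring
    rw [smul_eq_mul, ← this]
    ring
  rw [hφ] at hkey
  simp only at hkey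
  rw [← mul_assoc] at hkey
  have := mul_right_cancel₀ hexp hkey
  rw [Complex.ofReal_div, eq_div_iff hΓ, this]

/-- The truncated two-sided Laplace integral `∫₀ᵀ u(t) e^{ct} dt`. -/
noncomputable def expIntegral (T : ℝ) (u : ℝ → ℝ) (c : ℂ) : ℂ :=
  ∫ t in (0 : ℝ)..T, (u t : ℂ) * Complex.exp (c * t)

lemma continuous_expIntegral (T : ℝ) {u : ℝ → ℝ} (hu : Continuous u) {c : ℝ → ℂ}
    (hc : Continuous c) : Continuous fun y => expIntegral T u (c y) := by
  unfold expIntegral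
  exact intervalIntegral.continuous_parametric_intervalIntegral_of_continuous'
    (f := fun y t => (u t : ℂ) * Complex.exp (c y * t)) (by fun_prop) 0 T

lemma mul_expIntegral (T : ℝ) {u u' : ℝ → ℝ} (hu : ∀ t, HasDerivAt u (u' t) t)
    (hu' : Continuous u') (c : ℂ) :
    c * expIntegral T u c = u T * Complex.exp (c * T) - u 0 - expIntegral T u' c := by
  have hexp : ∀ t : ℝ, HasDerivAt (fun t : ℝ => Complex.exp (c * t)) (c * Complex.exp (c * t)) t := by
    intro t
    have h := ((Complex.ofRealCLM.hasDerivAt (x := t)).const_mul c).cexp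
    convert! h using 1
    simp [mul_comm]
  have h := intervalIntegral.integral_mul_deriv_eq_deriv_mul (a := 0) (b := T)
    (fun t _ => (hu t).ofReal_comp) (fun t _ => hexp t)
    (Continuous.intervalIntegrable (by fun_prop) _ _)
    (Continuous.intervalIntegrable (by fun_prop) _ _)
  simp only [Complex.ofReal_zero, mul_zero, Complex.exp_zero, mul_one] at h
  rw [expIntegral, expIntegral, ← h, ← intervalIntegral.integral_const_mul]
  congr 1
  ext t
  ring

lemma exists_norm_expIntegral_le {T : ℝ} (hT : 0 ≤ T) {u u' : ℝ → ℝ}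
    (hu : ∀ t, HasDerivAt u (u' t) t) (hu' : Continuous u') {ε : ℝ} (hε : 0 < ε) :
    ∃ C, ∀ y, ‖expIntegral T u (-verticalLine ε y)‖ ≤ C * ‖verticalLine ε y‖ ^ (-1 : ℝ) := by
  obtain ⟨M, hM⟩ := isCompact_Icc.exists_bound_of_continuousOn (hu'.continuousOn (s := Icc 0 T))
  refine ⟨|u T| + |u 0| + M * |T - 0|, fun y => ?_⟩
  have hz := norm_pos_iff.2 (verticalLine_ne_zero hε y)
  have hexp : ∀ t : ℝ, 0 ≤ t → ‖Complex.exp (-verticalLine ε y * t)‖ ≤ 1 := by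
    intro t ht
    rw [Complex.norm_exp, Real.exp_le_one_iff]
    simpa using mul_nonneg hε.le ht
  rw [Real.rpow_neg_one, ← div_eq_mul_inv, le_div_iff₀ hz, mul_comm, ← norm_neg (verticalLine ε y),
    ← norm_mul, mul_expIntegral T hu hu']
  refine (norm_sub_le _ _).trans (add_le_add ((norm_sub_le _ _).trans (add_le_add ?_ ?_)) ?_)
  · rw [norm_mul, Complex.norm_real, Real.norm_eq_abs]
    exact mul_le_of_le_one_right (abs_nonneg _) (hexp T hT)
  · simp
  · refine intervalIntegral.norm_integral_le_of_norm_le_const fun t ht => ?_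
    rw [uIoc_of_le hT] at ht
    rw [norm_mul, Complex.norm_real]
    exact (mul_le_of_le_one_right (norm_nonneg _) (hexp t ht.1.le)).trans (hM t ⟨ht.1.le, ht.2⟩)

lemma intervalIntegral_mul_integral_swap {T : ℝ} {f : ℝ → ℝ} (hf : Continuous f) {g : ℝ → ℂ}
    (hg : Integrable g) {c : ℝ → ℂ} (hc : Continuous c) {ρ : ℝ} (hρ : ∀ y, (c y).re = ρ) :
    ∫ t in (0 : ℝ)..T, (f t : ℂ) * ∫ y, g y * Complex.exp (c y * t)
      = ∫ y, g y * expIntegral T f (c y) := by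
  have h : Integrable (Function.uncurry fun (t y : ℝ) => (f t : ℂ) * (g y * Complex.exp (c y * t)))
      ((volume.restrict (uIoc 0 T)).prod volume) := by
    have h1 : Integrable (fun t => |f t| * Real.exp (ρ * t)) (volume.restrict (uIoc 0 T)) :=
      intervalIntegrable_iff.1 (Continuous.intervalIntegrable (by fun_prop) _ _)
    refine (h1.mul_prod hg.norm).mono' ?_ (Eventually.of_forall fun p => ?_)
    · have hg' : AEStronglyMeasurable (fun p : ℝ × ℝ => g p.2)
          ((volume.restrict (uIoc 0 T)).prod volume) := hg.aestronglyMeasurable.comp_snd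
      have h2 : Continuous fun p : ℝ × ℝ => Complex.exp (c p.2 * p.1) := by fun_prop
      have h3 : Continuous fun p : ℝ × ℝ => (f p.1 : ℂ) := by fun_prop
      exact h3.aestronglyMeasurable.mul (hg'.mul h2.aestronglyMeasurable)
    · simp only [Function.uncurry, norm_mul, Complex.norm_real, Complex.norm_exp, Real.norm_eq_abs]
      simp only [Complex.mul_re, hρ, Complex.ofReal_re, Complex.ofReal_im, mul_zero, sub_zero]
      exact le_of_eq (by ring)
  simp_rw [← MeasureTheory.integral_const_mul, intervalIntegral.intervalIntegral_eq_integral_uIoc]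
  rw [MeasureTheory.integral_integral_swap h, ← MeasureTheory.integral_smul]
  congr 1
  ext y
  rw [expIntegral, intervalIntegral.intervalIntegral_eq_integral_uIoc, mul_smul_comm,
    ← MeasureTheory.integral_const_mul]
  congr 2
  ext t
  ring

/-- The Riemann--Liouville integral of order `α + 1`. -/
noncomputable def fracIntegral (α : ℝ) (w : ℝ → ℝ) (τ : ℝ) : ℝ :=
  ∫ s in (0 : ℝ)..τ, ((τ - s) ^ α / Real.Gamma (α + 1)) * w s

/-- The kernel of the Riemann--Liouville integral of order `b + 1`, extended by zero. -/
noncomputable def fracKernel (b t : ℝ) : ℝ := max t 0 ^ b / Real.Gamma (b + 1)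

lemma continuous_fracKernel {b : ℝ} (hb : 0 ≤ b) : Continuous (fracKernel b) :=
  ((continuous_id.max continuous_const).rpow_const fun _ => Or.inr hb).div_const _

lemma fracKernel_of_nonpos {b : ℝ} (hb : 0 < b) {t : ℝ} (ht : t ≤ 0) : fracKernel b t = 0 := by
  simp [fracKernel, max_eq_right ht, Real.zero_rpow hb.ne']

lemma hasDerivAt_fracKernel {α : ℝ} (hα : -1 < α) {t : ℝ} (ht : 0 < t) :
    HasDerivAt (fracKernel (α + 1)) (t ^ α / Real.Gamma (α + 1)) t := by
  have h : HasDerivAt (fun t : ℝ => t ^ (α + 1) / Real.Gamma (α + 1 + 1))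
      (t ^ α / Real.Gamma (α + 1)) t := by
    have h := (Real.hasDerivAt_rpow_const (x := t) (p := α + 1) (Or.inl ht.ne')).div_const
      (Real.Gamma (α + 1 + 1))
    have hα1 : α + 1 ≠ 0 := by linarith
    have hΓ := (Real.Gamma_pos_of_pos (show 0 < α + 1 by linarith)).ne'
    convert! h using 1
    rw [Real.Gamma_add_one hα1, add_sub_cancel_right]
    field_simp
  refine h.congr_of_eventuallyEq ?_
  filter_upwards [Ioi_mem_nhds ht] with s hs
  simp only [fracKernel, max_eq_left (le_of_lt (mem_Ioi.1 hs))]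

lemma intervalIntegrable_rpow_div {α : ℝ} (hα : -1 < α) (a b : ℝ) :
    IntervalIntegrable (fun t : ℝ => t ^ α / Real.Gamma (α + 1)) volume a b :=
  (intervalIntegral.intervalIntegrable_rpow' hα).div_const _

lemma fracIntegral_eq_fracKernel {α T : ℝ} (hα : -1 < α) {w w' : ℝ → ℝ}
    (hw : ∀ t, HasDerivAt w (w' t) t) (hw' : Continuous w') {t : ℝ} (ht : t ∈ Icc 0 T) :
    fracIntegral α w t
      = w 0 * fracKernel (α + 1) t + ∫ s in (0 : ℝ)..T, w' s * fracKernel (α + 1) (t - s) := by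
  have hα1 : 0 < α + 1 := by linarith
  have hκ := continuous_fracKernel hα1.le
  have hwc : Continuous w := continuous_iff_continuousAt.2 fun t => (hw t).continuousAt
  have h := intervalIntegral.integral_mul_deriv_eq_deriv_mul_of_hasDerivAt (a := 0) (b := t)
    (u := w) (u' := w') (v := fun s => -fracKernel (α + 1) (t - s))
    (v' := fun s => (t - s) ^ α / Real.Gamma (α + 1)) hwc.continuousOn
    (by fun_prop) (fun s _ => hw s) ?_ (hw'.intervalIntegrable _ _) ?_
  · have h0 : ∫ s in t..T, w' s * fracKernel (α + 1) (t - s) = 0 := by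
      rw [← intervalIntegral.integral_zero (a := t) (b := T)]
      refine intervalIntegral.integral_congr fun s hs => ?_
      rw [uIcc_of_le ht.2] at hs
      rw [fracKernel_of_nonpos hα1 (by linarith [hs.1]), mul_zero]
    rw [← intervalIntegral.integral_add_adjacent_intervals (b := t)
      (Continuous.intervalIntegrable (by fun_prop) _ _)
      (Continuous.intervalIntegrable (by fun_prop) _ _), h0]
    simp only [fracIntegral, mul_comm _ (w _), h]
    simp [fracKernel_of_nonpos hα1 le_rfl]
  · intro s hs
    rw [max_eq_right ht.1] at hs
    have := ((hasDerivAt_fracKernel hα (sub_pos.2 hs.2)).comp_const_sub t s).neg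
    simpa [Pi.neg_def] using this
  · have := (intervalIntegrable_rpow_div hα t 0).comp_sub_left t
    simpa using this

lemma fracIntegral_eq_integral_verticalLine {α T ε : ℝ} (hα : -1 < α) (hε : 0 < ε)
    {w w' : ℝ → ℝ} (hw : ∀ t, HasDerivAt w (w' t) t) (hw' : Continuous w') {t : ℝ}
    (ht : t ∈ Icc 0 T) :
    (fracIntegral α w t : ℂ) = ∫ y, (verticalLine ε y ^ (-((α + 1 : ℝ) : ℂ))
      * expIntegral T w (-verticalLine ε y)) * Complex.exp (verticalLine ε y * t) := by
  have hα1 : 0 < α + 1 := by linarith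
  set p : ℝ → ℂ := fun y => verticalLine ε y ^ (-((α + 1 + 1 : ℝ) : ℂ)) with hp
  have hpc : Continuous p := continuous_verticalLine_cpow hε _
  have hz := continuous_verticalLine ε
  have hK : ∀ x : ℝ, ∫ y, p y * Complex.exp (verticalLine ε y * x) = (fracKernel (α + 1) x : ℂ) :=
    fun x => integral_verticalLine_cpow_mul_cexp hα1 hε x
  have hpi : ∀ x : ℝ, Integrable fun y => p y * Complex.exp (verticalLine ε y * x) := by
    intro x
    refine integrable_of_norm_le_verticalLine (r := -(α + 1 + 1)) (C := Real.exp (ε * x)) hε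
      (by linarith) (by fun_prop) fun y => le_of_eq ?_
    rw [norm_mul, hp, ← Complex.ofReal_neg, norm_verticalLine_cpow hε, Complex.norm_exp, mul_comm]
    simp
  have hI : ((∫ s in (0 : ℝ)..T, w' s * fracKernel (α + 1) (t - s) : ℝ) : ℂ)
      = ∫ y, (p y * Complex.exp (verticalLine ε y * t)) * expIntegral T w' (-verticalLine ε y) := by
    rw [← intervalIntegral_mul_integral_swap hw' (hpi t) (c := fun y => -verticalLine ε y)
        hz.neg (ρ := -ε) (by simp),
      ← intervalIntegral.integral_ofReal]
    refine intervalIntegral.integral_congr fun s _ => ?_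
    simp only [Complex.ofReal_mul, ← hK]
    congr 2
    ext y
    rw [mul_assoc, ← Complex.exp_add]
    congr 2
    push_cast
    ring
  have hI' : Integrable fun y =>
      (p y * Complex.exp (verticalLine ε y * t)) * expIntegral T w' (-verticalLine ε y) := by
    obtain ⟨M, hM⟩ : ∃ M, ∀ y, ‖expIntegral T w' (-verticalLine ε y)‖ ≤ M := by
      refine ⟨∫ s in (0 : ℝ)..T, |w' s| * Real.exp (-ε * s), fun y => ?_⟩
      refine (intervalIntegral.norm_integral_le_integral_norm (ht.1.trans ht.2)).trans_eq ?_
      refine intervalIntegral.integral_congr fun s _ => ?_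
      simp [Complex.norm_exp]
    exact (hpi t).mul_bdd (c := M)
      (continuous_expIntegral T hw' hz.neg).aestronglyMeasurable (Eventually.of_forall hM)
  have hT0 : fracKernel (α + 1) (t - T) = 0 := fracKernel_of_nonpos hα1 (by linarith [ht.2])
  have hT0' := hK (t - T)
  rw [hT0] at hT0'
  have key : (fracIntegral α w t : ℂ) = w 0 * (fracKernel (α + 1) t : ℂ)
      + ((∫ s in (0 : ℝ)..T, w' s * fracKernel (α + 1) (t - s) : ℝ) : ℂ)
      - w T * ((0 : ℝ) : ℂ) := by
    rw [fracIntegral_eq_fracKernel hα hw hw' ht]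
    push_cast
    ring
  have hI₁ : Integrable fun y => w 0 * (p y * Complex.exp (verticalLine ε y * t))
      + (p y * Complex.exp (verticalLine ε y * t)) * expIntegral T w' (-verticalLine ε y) :=
    ((hpi t).const_mul _).add hI'
  rw [key, hI, ← hT0', ← hK t, ← MeasureTheory.integral_const_mul,
    ← MeasureTheory.integral_const_mul, ← MeasureTheory.integral_add ((hpi t).const_mul _) hI',
    ← MeasureTheory.integral_sub hI₁ ((hpi (t - T)).const_mul _)]
  congr 1
  ext y
  have h1 := mul_expIntegral T hw hw' (-verticalLine ε y)
  have h2 : expIntegral T w' (-verticalLine ε y) = w T * Complex.exp (-verticalLine ε y * T) - w 0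
      + verticalLine ε y * expIntegral T w (-verticalLine ε y) := by
    linear_combination h1
  have h3 : verticalLine ε y ^ (-((α + 1 : ℝ) : ℂ)) = p y * verticalLine ε y := by
    have h : (-((α + 1 : ℝ) : ℂ)) = -((α + 1 + 1 : ℝ) : ℂ) + 1 := by
      push_cast
      ring
    rw [h, Complex.cpow_add _ _ (verticalLine_ne_zero hε y), Complex.cpow_one]
  have h4 : Complex.exp (verticalLine ε y * ((t - T : ℝ) : ℂ))
      = Complex.exp (verticalLine ε y * t) * Complex.exp (-verticalLine ε y * T) := by
    rw [← Complex.exp_add]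
    congr 1
    push_cast
    ring
  rw [h2, h3, h4]
  ring

lemma hasDerivAt_convolution_posPart {α T C : ℝ} (hα : -1 < α) (hT : 0 ≤ T) {w w' : ℝ → ℝ}
    (hw : ∀ t, HasDerivAt w (w' t) t) (hC : ∀ t, |w' t| ≤ C) (t : ℝ) :
    HasDerivAt (fun t => ∫ h in (0 : ℝ)..T,
        (h ^ α / Real.Gamma (α + 1)) * (w (max (t - h) 0) - w 0))
      (∫ h in (0 : ℝ)..T, (h ^ α / Real.Gamma (α + 1)) * (if h < t then w' (t - h) else 0)) t := by
  have hwc : Continuous w := continuous_iff_continuousAt.2 fun t => (hw t).continuousAt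
  have hw'eq : w' = deriv w := funext fun t => (hw t).deriv.symm
  have hC0 : 0 ≤ C := (abs_nonneg _).trans (hC 0)
  have hlip : LipschitzWith ⟨C, hC0⟩ w :=
    lipschitzWith_of_nnnorm_deriv_le (𝕜 := ℝ) (fun t => (hw t).differentiableAt) fun t => by
      rw [(hw t).deriv]
      exact hC t
  have hw'm : Measurable w' := hw'eq ▸ measurable_deriv w
  have hk : Measurable fun h : ℝ => h ^ α / Real.Gamma (α + 1) := by fun_prop
  have hki := intervalIntegrable_rpow_div hα 0 T
  have hΓ := Real.Gamma_pos_of_pos (show 0 < α + 1 by linarith)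
  refine (intervalIntegral.hasDerivAt_integral_of_dominated_loc_of_lip (s := univ)
    (bound := fun h => (h ^ α / Real.Gamma (α + 1)) * C) univ_mem
    (Eventually.of_forall fun x => ?_) ?_ ?_ (Eventually.of_forall fun h hh => ?_)
    (hki.mul_const C) ?_).2
  · exact (hk.mul (by fun_prop)).aestronglyMeasurable
  · exact hki.mul_continuousOn (by fun_prop)
  · exact (hk.mul (Measurable.ite measurableSet_Iio (by fun_prop)
      measurable_const)).aestronglyMeasurable
  · rw [uIoc_of_le hT] at hh
    have hk0 : 0 ≤ h ^ α / Real.Gamma (α + 1) := div_nonneg (Real.rpow_nonneg hh.1.le _) hΓ.le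
    refine LipschitzOnWith.of_dist_le_mul fun x _ y _ => ?_
    have h1 := hlip.dist_le_mul (max (x - h) 0) (max (y - h) 0)
    have h2 : |max (x - h) 0 - max (y - h) 0| ≤ |x - y| := by
      refine (abs_max_sub_max_le_abs _ _ _).trans_eq ?_
      congr 1
      ring
    rw [Real.dist_eq, Real.dist_eq] at h1
    simp only [Real.coe_nnabs, Real.dist_eq, abs_of_nonneg (mul_nonneg hk0 hC0)]
    rw [← mul_sub, abs_mul, abs_of_nonneg hk0, mul_assoc, sub_sub_sub_cancel_right]
    refine mul_le_mul_of_nonneg_left (h1.trans ?_) hk0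
    exact mul_le_mul_of_nonneg_left h2 hC0
  · have hne : ∀ᵐ h : ℝ, h ≠ t := by simp [ae_iff]
    filter_upwards [hne] with h hne _
    refine HasDerivAt.const_mul _ (HasDerivAt.sub_const _ ?_)
    rcases lt_or_gt_of_ne hne with hlt | hgt
    · rw [if_pos hlt]
      refine ((hw (t - h)).comp_sub_const t h).congr_of_eventuallyEq ?_
      filter_upwards [Ioi_mem_nhds hlt] with x hx
      rw [max_eq_left (sub_nonneg.2 (le_of_lt (mem_Ioi.1 hx)))]
    · rw [if_neg hgt.le.not_gt]
      refine (hasDerivAt_const t (w 0)).congr_of_eventuallyEq ?_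
      filter_upwards [Iio_mem_nhds hgt] with x hx
      rw [max_eq_right (sub_nonpos.2 (le_of_lt (mem_Iio.1 hx)))]

lemma fracIntegral_eq_convolution_posPart {α T : ℝ} (hα : -1 < α) {w : ℝ → ℝ}
    (hw : Continuous w) {t : ℝ} (ht : t ∈ Icc 0 T) :
    fracIntegral α w t = w 0 * fracKernel (α + 1) t
      + ∫ h in (0 : ℝ)..T, (h ^ α / Real.Gamma (α + 1)) * (w (max (t - h) 0) - w 0) := by
  have hα1 : 0 < α + 1 := by linarith
  have hk : ∀ a b, IntervalIntegrable (fun h : ℝ => h ^ α / Real.Gamma (α + 1)) volume a b :=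
    intervalIntegrable_rpow_div hα
  have hi : ∀ a b, IntervalIntegrable
      (fun h : ℝ => (h ^ α / Real.Gamma (α + 1)) * (w (max (t - h) 0) - w 0)) volume a b :=
    fun a b => (hk a b).mul_continuousOn (by fun_prop)
  have h1 : ∫ h in (0 : ℝ)..t, h ^ α / Real.Gamma (α + 1) = fracKernel (α + 1) t := by
    rw [intervalIntegral.integral_eq_sub_of_hasDerivAt_of_le ht.1
      (continuous_fracKernel hα1.le).continuousOn
      (fun x hx => hasDerivAt_fracKernel hα hx.1) (hk 0 t), fracKernel_of_nonpos hα1 le_rfl,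
      sub_zero]
  have h2 : ∫ h in t..T, (h ^ α / Real.Gamma (α + 1)) * (w (max (t - h) 0) - w 0) = 0 := by
    rw [← intervalIntegral.integral_zero (a := t) (b := T)]
    refine intervalIntegral.integral_congr fun h hh => ?_
    rw [uIcc_of_le ht.2] at hh
    simp [max_eq_right (sub_nonpos.2 hh.1)]
  rw [← intervalIntegral.integral_add_adjacent_intervals (hi 0 t) (hi t T), h2, add_zero, ← h1,
    ← intervalIntegral.integral_const_mul, ← intervalIntegral.integral_add ((hk 0 t).const_mul _)
    (hi 0 t), fracIntegral]
  have hsub := intervalIntegral.integral_comp_sub_left (a := 0) (b := t)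
    (fun h => (h ^ α / Real.Gamma (α + 1)) * w (t - h)) t
  simp only [sub_sub_cancel, sub_self, sub_zero] at hsub
  rw [hsub]
  refine intervalIntegral.integral_congr fun h hh => ?_
  rw [uIcc_of_le ht.1] at hh
  simp only [max_eq_left (sub_nonneg.2 hh.2)]
  ring

/-- Regularity on `[0, T]` of the Riemann--Liouville integral of a Lipschitz differentiable
function. -/
lemma fracIntegral_regularity {α T C : ℝ} (hα : -1 < α) (hT : 0 ≤ T) {w w' : ℝ → ℝ}
    (hw : ∀ t, HasDerivAt w (w' t) t) (hC : ∀ t, |w' t| ≤ C) :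
    ContinuousOn (fracIntegral α w) (Icc 0 T) ∧
      (∀ t ∈ Ioo 0 T, HasDerivAt (fracIntegral α w) (deriv (fracIntegral α w) t) t) ∧
      IntervalIntegrable (deriv (fracIntegral α w)) volume 0 T := by
  have hwc : Continuous w := continuous_iff_continuousAt.2 fun t => (hw t).continuousAt
  have hα1 : 0 < α + 1 := by linarith
  set G : ℝ → ℝ := fun t => ∫ h in (0 : ℝ)..T,
    (h ^ α / Real.Gamma (α + 1)) * (w (max (t - h) 0) - w 0) with hG
  set G' : ℝ → ℝ := fun t => ∫ h in (0 : ℝ)..T,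
    (h ^ α / Real.Gamma (α + 1)) * (if h < t then w' (t - h) else 0) with hG'
  have hGd : ∀ t, HasDerivAt G (G' t) t := hasDerivAt_convolution_posPart hα hT hw hC
  have hGc : Continuous G := continuous_iff_continuousAt.2 fun t => (hGd t).continuousAt
  have heq : EqOn (fracIntegral α w) (fun t => w 0 * fracKernel (α + 1) t + G t) (Icc 0 T) :=
    fun t ht => fracIntegral_eq_convolution_posPart hα hwc ht
  have hder : ∀ t ∈ Ioo 0 T, HasDerivAt (fracIntegral α w)
      (w 0 * (t ^ α / Real.Gamma (α + 1)) + G' t) t := fun t ht =>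
    (((hasDerivAt_fracKernel hα ht.1).const_mul _).add (hGd t)).congr_of_eventuallyEq
      (heq.eventuallyEq_of_mem (Icc_mem_nhds ht.1 ht.2))
  refine ⟨ContinuousOn.congr (Continuous.continuousOn ?_) heq,
    fun t ht => (hder t ht).differentiableAt.hasDerivAt, ?_⟩
  · exact (continuous_const.mul (continuous_fracKernel hα1.le)).add hGc
  have hG'm : Measurable G' := by
    have : G' = deriv G := funext fun t => (hGd t).deriv.symm
    exact this ▸ measurable_deriv G
  have hΓ := Real.Gamma_pos_of_pos hα1
  have hG'b : ∀ t, ‖G' t‖ ≤ ∫ h in (0 : ℝ)..T, (h ^ α / Real.Gamma (α + 1)) * C := by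
    intro t
    refine intervalIntegral.norm_integral_le_of_norm_le hT (Eventually.of_forall fun h hh => ?_)
      ((intervalIntegrable_rpow_div hα 0 T).mul_const C)
    have hk0 : 0 ≤ h ^ α / Real.Gamma (α + 1) := div_nonneg (Real.rpow_nonneg hh.1.le _) hΓ.le
    rw [norm_mul, Real.norm_of_nonneg hk0]
    refine mul_le_mul_of_nonneg_left ?_ hk0
    split_ifs
    · exact hC _
    · simpa using (abs_nonneg _).trans (hC 0)
  have hG'i : IntervalIntegrable G' volume 0 T :=
    (intervalIntegrable_const (c := ∫ h in (0 : ℝ)..T, (h ^ α / Real.Gamma (α + 1)) * C)).mono_fun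
      hG'm.aestronglyMeasurable
      (Eventually.of_forall fun t => (hG'b t).trans (le_abs_self _))
  refine (((intervalIntegrable_rpow_div hα 0 T).const_mul (w 0)).add hG'i).congr_uIoo
    fun t ht => ?_
  rw [uIoo_of_le hT] at ht
  exact (hder t ht).deriv.symm

lemma conj_expIntegral_neg_verticalLine (T ε y : ℝ) (v : ℝ → ℝ) :
    (starRingEnd ℂ) (expIntegral T v (-verticalLine ε y))
      = expIntegral T (fun t => Real.exp (-2 * ε * t) * v t) (verticalLine ε y) := by
  rw [expIntegral, expIntegral, ← intervalIntegral.intervalIntegral_conj]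
  refine intervalIntegral.integral_congr fun t _ => ?_
  simp only [map_mul, Complex.conj_ofReal, ← Complex.exp_conj, Complex.ofReal_mul,
    Complex.ofReal_exp]
  rw [mul_comm (Complex.exp _), mul_assoc, ← Complex.exp_add]
  congr 2
  simp only [verticalLine, map_neg, map_add, map_mul, Complex.conj_ofReal, Complex.conj_I,
    Complex.ofReal_neg, Complex.ofReal_ofNat, map_ofNat]
  ring

/-- Plancherel-type identity for the exponentially damped bilinear form of the Riemann--Liouville
derivative. -/
lemma integral_mul_deriv_fracIntegral_eq {α T C ε : ℝ} (hα : -1 < α) (hT : 0 ≤ T) (hε : 0 < ε)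
    {v v' w w' : ℝ → ℝ} (hv : ∀ t, HasDerivAt v (v' t) t) (hv' : Continuous v')
    (hw : ∀ t, HasDerivAt w (w' t) t) (hw' : Continuous w') (hC : ∀ t, |w' t| ≤ C) :
    ((∫ t in (0 : ℝ)..T, Real.exp (-2 * ε * t) * v t * deriv (fracIntegral α w) t : ℝ) : ℂ)
      = ∫ y, verticalLine ε y ^ (((-α : ℝ) : ℂ)) * (expIntegral T w (-verticalLine ε y)
        * (starRingEnd ℂ) (expIntegral T v (-verticalLine ε y))) := by
  obtain ⟨hFc, hFd, hFi⟩ := fracIntegral_regularity hα hT hw hC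
  have hvc : Continuous v := continuous_iff_continuousAt.2 fun t => (hv t).continuousAt
  have hwc : Continuous w := continuous_iff_continuousAt.2 fun t => (hw t).continuousAt
  have hz := continuous_verticalLine ε
  set u : ℝ → ℝ := fun t => Real.exp (-2 * ε * t) * v t with hu_def
  set u' : ℝ → ℝ := fun t => Real.exp (-2 * ε * t) * (-2 * ε) * v t
    + Real.exp (-2 * ε * t) * v' t with hu'_def
  have hu : ∀ t, HasDerivAt u (u' t) t := by
    intro t
    have h : HasDerivAt (fun t => -2 * ε * t) (-2 * ε) t := by
      simpa using (hasDerivAt_id t).const_mul (-2 * ε)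
    exact h.exp.mul (hv t)
  have huc : Continuous u := by fun_prop
  have hu' : Continuous u' := by fun_prop
  have hibp := intervalIntegral.integral_mul_deriv_eq_deriv_mul_of_hasDerivAt (a := 0) (b := T)
    (u := u) (u' := u') (v := fracIntegral α w) (v' := deriv (fracIntegral α w))
    huc.continuousOn (by rwa [uIcc_of_le hT]) (fun t _ => hu t)
    (by rwa [min_eq_left hT, max_eq_right hT]) (hu'.intervalIntegrable _ _) hFi
  set g : ℝ → ℂ := fun y => verticalLine ε y ^ (-((α + 1 : ℝ) : ℂ))
    * expIntegral T w (-verticalLine ε y) with hg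
  have hgi : Integrable g := by
    obtain ⟨M, hM⟩ := exists_norm_expIntegral_le hT hw hw' hε
    refine integrable_of_norm_le_verticalLine (r := -(α + 1) + -1) (C := M) hε (by linarith)
      ((continuous_verticalLine_cpow hε _).mul (continuous_expIntegral T hwc hz.neg)) fun y => ?_
    have hz0 := norm_pos_iff.2 (verticalLine_ne_zero hε y)
    rw [hg, norm_mul, ← Complex.ofReal_neg, norm_verticalLine_cpow hε, Real.rpow_add hz0,
      mul_left_comm]
    exact mul_le_mul_of_nonneg_left (hM y) (by positivity)
  have hF : ∀ t ∈ Icc 0 T, (fracIntegral α w t : ℂ)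
      = ∫ y, g y * Complex.exp (verticalLine ε y * t) := fun t ht =>
    fracIntegral_eq_integral_verticalLine hα hε hw hw' ht
  have hgexp : ∀ t : ℝ, Integrable fun y => g y * Complex.exp (verticalLine ε y * t) := by
    intro t
    refine hgi.mul_bdd (c := Real.exp (ε * t))
      (Continuous.aestronglyMeasurable (by fun_prop)) (Eventually.of_forall fun y => ?_)
    simp [Complex.norm_exp]
  have hmid : ((∫ t in (0 : ℝ)..T, u' t * fracIntegral α w t : ℝ) : ℂ)
      = ∫ y, g y * expIntegral T u' (verticalLine ε y) := by
    rw [← intervalIntegral_mul_integral_swap hu' hgi hz (ρ := ε) (by simp),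
      ← intervalIntegral.integral_ofReal]
    refine intervalIntegral.integral_congr fun t ht => ?_
    rw [uIcc_of_le hT] at ht
    simp only [Complex.ofReal_mul, hF t ht]
  have hmidi : Integrable fun y => g y * expIntegral T u' (verticalLine ε y) := by
    refine hgi.mul_bdd (c := ∫ s in (0 : ℝ)..T, |u' s| * Real.exp (ε * s))
      (continuous_expIntegral T hu' hz).aestronglyMeasurable (Eventually.of_forall fun y => ?_)
    refine (intervalIntegral.norm_integral_le_integral_norm hT).trans_eq ?_
    refine intervalIntegral.integral_congr fun s _ => ?_
    simp [Complex.norm_exp]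
  have hends : Integrable fun y => u T * (g y * Complex.exp (verticalLine ε y * T))
      - u 0 * (g y * Complex.exp (verticalLine ε y * (0 : ℝ))) :=
    ((hgexp T).const_mul _).sub ((hgexp 0).const_mul _)
  rw [hibp, Complex.ofReal_sub, Complex.ofReal_sub, Complex.ofReal_mul (u T),
    Complex.ofReal_mul (u 0), hF T ⟨hT, le_rfl⟩, hF 0 ⟨le_rfl, hT⟩, hmid, ← MeasureTheory.integral_const_mul,
    ← MeasureTheory.integral_const_mul,
    ← MeasureTheory.integral_sub ((hgexp T).const_mul _) ((hgexp 0).const_mul _),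
    ← MeasureTheory.integral_sub hends hmidi]
  congr 1
  ext y
  have h1 := mul_expIntegral T hu hu' (verticalLine ε y)
  have h2 : verticalLine ε y ^ (((-α : ℝ) : ℂ))
      = verticalLine ε y ^ (-((α + 1 : ℝ) : ℂ)) * verticalLine ε y := by
    have h : (((-α : ℝ) : ℂ)) = -((α + 1 : ℝ) : ℂ) + 1 := by
      push_cast
      ring
    rw [h, Complex.cpow_add _ _ (verticalLine_ne_zero hε y), Complex.cpow_one]
  rw [conj_expIntegral_neg_verticalLine, h2]
  simp only [Complex.ofReal_zero, mul_zero, Complex.exp_zero, mul_one, hg]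
  linear_combination (-(verticalLine ε y ^ (-((α + 1 : ℝ) : ℂ))
    * expIntegral T w (-verticalLine ε y))) * h1

lemma cos_mul_norm_rpow_le_re_cpow {r : ℝ} (hr0 : 0 ≤ r) (hr1 : r ≤ 1) {z : ℂ} (hz : 0 < z.re) :
    Real.cos (r * π / 2) * ‖z‖ ^ r ≤ (z ^ (r : ℂ)).re := by
  rw [Complex.cpow_ofReal_re, mul_comm]
  refine mul_le_mul_of_nonneg_left ?_ (Real.rpow_nonneg (norm_nonneg _) _)
  have harg : |z.arg| ≤ π / 2 := (Complex.abs_arg_lt_pi_div_two_iff.2 (Or.inl hz)).le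
  rw [← Real.cos_abs (z.arg * r), abs_mul, abs_of_nonneg hr0]
  refine Real.cos_le_cos_of_nonneg_of_le_pi (by positivity) ?_ ?_
  · nlinarith [Real.pi_pos]
  · nlinarith [Real.pi_pos]

lemma integral_mul_le_sqrt_mul_sqrt_s9 {X : Type*} [MeasurableSpace X] {μ : Measure X} {f g : X → ℝ}
    (hf0 : ∀ x, 0 ≤ f x) (hg0 : ∀ x, 0 ≤ g x) (hfm : AEStronglyMeasurable f μ)
    (hgm : AEStronglyMeasurable g μ) (hf : Integrable (fun x => f x ^ 2) μ)
    (hg : Integrable (fun x => g x ^ 2) μ) :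
    ∫ x, f x * g x ∂μ ≤ √(∫ x, f x ^ 2 ∂μ) * √(∫ x, g x ^ 2 ∂μ) := by
  have h := integral_mul_le_Lp_mul_Lq_of_nonneg (μ := μ) Real.HolderConjugate.two_two
    (Eventually.of_forall hf0) (Eventually.of_forall hg0)
    (by simpa using (memLp_two_iff_integrable_sq hfm).2 hf)
    (by simpa using (memLp_two_iff_integrable_sq hgm).2 hg)
  simpa [Real.sqrt_eq_rpow] using h

lemma norm_verticalLine_cpow_mul_conj {ε : ℝ} (hε : 0 < ε) (r y : ℝ) (a b : ℂ) :
    ‖verticalLine ε y ^ (r : ℂ) * (a * (starRingEnd ℂ) b)‖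
      = ‖verticalLine ε y‖ ^ r * (‖a‖ * ‖b‖) := by
  rw [norm_mul, norm_mul, RCLike.norm_conj, norm_verticalLine_cpow hε]

lemma integrable_verticalLine_cpow_mul_conj {ε r a b : ℝ} (hε : 0 < ε) (hr : r < 1)
    {P Q : ℝ → ℂ} (hPc : Continuous P) (hQc : Continuous Q)
    (hP : ∀ y, ‖P y‖ ≤ a * ‖verticalLine ε y‖ ^ (-1 : ℝ))
    (hQ : ∀ y, ‖Q y‖ ≤ b * ‖verticalLine ε y‖ ^ (-1 : ℝ)) :
    Integrable fun y => verticalLine ε y ^ (r : ℂ) * (P y * (starRingEnd ℂ) (Q y)) := by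
  have hzn : ∀ y, 0 < ‖verticalLine ε y‖ := fun y => norm_pos_iff.2 (verticalLine_ne_zero hε y)
  refine integrable_of_norm_le_verticalLine (r := r + (-1 + -1)) (C := a * b) hε (by linarith)
    ((continuous_verticalLine_cpow hε _).mul (hPc.mul (Complex.continuous_conj.comp hQc)))
    fun y => ?_
  rw [norm_verticalLine_cpow_mul_conj hε, Real.rpow_add (hzn y), Real.rpow_add (hzn y),
    mul_left_comm (a * b)]
  refine mul_le_mul_of_nonneg_left ?_ (Real.rpow_nonneg (hzn y).le _)
  refine (mul_le_mul (hP y) (hQ y) (norm_nonneg _) ((norm_nonneg _).trans (hP y))).trans_eq ?_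
  ring

lemma integral_norm_rpow_mul_norm_sq_le {α T C ε : ℝ} (hα : -1 < α) (hα0 : α < 0)
    (hT : 0 ≤ T) (hε : 0 < ε) {w w' : ℝ → ℝ} (hw : ∀ t, HasDerivAt w (w' t) t)
    (hw' : Continuous w') (hC : ∀ t, |w' t| ≤ C) :
    ∫ y, ‖verticalLine ε y‖ ^ (-α) * (‖expIntegral T w (-verticalLine ε y)‖
        * ‖expIntegral T w (-verticalLine ε y)‖)
      ≤ (1 / Real.cos (α * π / 2)) *
        ∫ t in (0 : ℝ)..T, Real.exp (-2 * ε * t) * w t * deriv (fracIntegral α w) t := by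
  have hcos : 0 < Real.cos (α * π / 2) :=
    Real.cos_pos_of_mem_Ioo ⟨by nlinarith [Real.pi_pos], by nlinarith [Real.pi_pos]⟩
  obtain ⟨B, hB⟩ := exists_norm_expIntegral_le hT hw hw' hε
  have hWc : Continuous fun y => expIntegral T w (-verticalLine ε y) := continuous_expIntegral T
    (continuous_iff_continuousAt.2 fun t => (hw t).continuousAt) (continuous_verticalLine ε).neg
  have hI := integrable_verticalLine_cpow_mul_conj (r := -α) hε (by linarith) hWc hWc hB hB
  have hid := congrArg Complex.re (integral_mul_deriv_fracIntegral_eq hα hT hε hw hw' hw hw' hC)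
  have hre : (∫ y, verticalLine ε y ^ (((-α : ℝ) : ℂ)) * (expIntegral T w (-verticalLine ε y)
      * (starRingEnd ℂ) (expIntegral T w (-verticalLine ε y)))).re
      = ∫ y, (verticalLine ε y ^ (((-α : ℝ) : ℂ)) * (expIntegral T w (-verticalLine ε y)
      * (starRingEnd ℂ) (expIntegral T w (-verticalLine ε y)))).re := (integral_re hI).symm
  rw [Complex.ofReal_re, hre] at hid
  rw [hid, one_div, inv_mul_eq_div, le_div_iff₀ hcos, ← MeasureTheory.integral_mul_const]
  have hIn := hI.norm
  simp only [norm_verticalLine_cpow_mul_conj hε] at hIn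
  refine integral_mono (hIn.mul_const _) hI.re fun y => ?_
  have hle := cos_mul_norm_rpow_le_re_cpow (r := -α) (by linarith) (by linarith)
    (z := verticalLine ε y) (by simpa using hε)
  rw [neg_mul, neg_div, Real.cos_neg] at hle
  simp only [Complex.mul_conj, Complex.re_mul_ofReal,
    Complex.normSq_eq_norm_sq]
  nlinarith [sq_nonneg ‖expIntegral T w (-verticalLine ε y)‖]

/-- The damped form of the Riemann--Liouville derivative satisfies a Cauchy--Schwarz inequality
with constant `1 / cos (απ/2)`. -/
lemma damped_integral_mul_deriv_fracIntegral_le {α T C D ε : ℝ} (hα : -1 < α) (hα0 : α < 0)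
    (hT : 0 ≤ T) (hε : 0 < ε)
    {v v' w w' : ℝ → ℝ} (hv : ∀ t, HasDerivAt v (v' t) t) (hv' : Continuous v')
    (hD : ∀ t, |v' t| ≤ D)
    (hw : ∀ t, HasDerivAt w (w' t) t) (hw' : Continuous w') (hC : ∀ t, |w' t| ≤ C) :
    ∫ t in (0 : ℝ)..T, Real.exp (-2 * ε * t) * v t * deriv (fracIntegral α w) t
      ≤ (1 / Real.cos (α * π / 2)) *
        √(∫ t in (0 : ℝ)..T, Real.exp (-2 * ε * t) * v t * deriv (fracIntegral α v) t) *
        √(∫ t in (0 : ℝ)..T, Real.exp (-2 * ε * t) * w t * deriv (fracIntegral α w) t) := by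
  have hz := continuous_verticalLine ε
  have hzn : ∀ y, 0 < ‖verticalLine ε y‖ := fun y => norm_pos_iff.2 (verticalLine_ne_zero hε y)
  have hcos : 0 < Real.cos (α * π / 2) :=
    Real.cos_pos_of_mem_Ioo ⟨by nlinarith [Real.pi_pos], by nlinarith [Real.pi_pos]⟩
  set V : ℝ → ℂ := fun y => expIntegral T v (-verticalLine ε y) with hV
  set W : ℝ → ℂ := fun y => expIntegral T w (-verticalLine ε y) with hW
  have hVc : Continuous V := continuous_expIntegral T
    (continuous_iff_continuousAt.2 fun t => (hv t).continuousAt) hz.neg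
  have hWc : Continuous W := continuous_expIntegral T
    (continuous_iff_continuousAt.2 fun t => (hw t).continuousAt) hz.neg
  obtain ⟨A, hA⟩ := exists_norm_expIntegral_le hT hv hv' hε
  obtain ⟨B, hB⟩ := exists_norm_expIntegral_le hT hw hw' hε
  have hVV := integral_norm_rpow_mul_norm_sq_le hα hα0 hT hε hv hv' hD
  have hWW := integral_norm_rpow_mul_norm_sq_le hα hα0 hT hε hw hw' hC
  have hsq : ∀ (P : ℝ → ℂ) (y : ℝ), ‖verticalLine ε y‖ ^ (-α) * (‖P y‖ * ‖P y‖)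
      = (‖verticalLine ε y‖ ^ (-α / 2) * ‖P y‖) ^ 2 := by
    intro P y
    rw [mul_pow, ← Real.rpow_mul_natCast (hzn y).le]
    push_cast
    rw [div_mul_cancel₀ _ two_ne_zero, sq]
  have hmeas : ∀ {P : ℝ → ℂ}, Continuous P →
      AEStronglyMeasurable (fun y => ‖verticalLine ε y‖ ^ (-α / 2) * ‖P y‖) volume := fun hP =>
    ((hz.norm.rpow_const fun y => Or.inl (hzn y).ne').mul hP.norm).aestronglyMeasurable
  have hintV := (integrable_verticalLine_cpow_mul_conj (r := -α) hε (by linarith) hVc hVc hA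
    hA).norm
  have hintW := (integrable_verticalLine_cpow_mul_conj (r := -α) hε (by linarith) hWc hWc hB
    hB).norm
  simp only [norm_verticalLine_cpow_mul_conj hε, hsq] at hintV hintW
  have hCS := integral_mul_le_sqrt_mul_sqrt_s9
    (fun y => by positivity) (fun y => by positivity) (hmeas hVc) (hmeas hWc) hintV hintW
  have hprod : ∀ y, ‖verticalLine ε y‖ ^ (-α / 2) * ‖V y‖
      * (‖verticalLine ε y‖ ^ (-α / 2) * ‖W y‖)
      = ‖verticalLine ε y ^ (((-α : ℝ) : ℂ)) * (W y * (starRingEnd ℂ) (V y))‖ := by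
    intro y
    rw [norm_verticalLine_cpow_mul_conj hε, mul_mul_mul_comm, ← Real.rpow_add (hzn y), add_halves, mul_comm ‖V y‖]
  simp only [hprod] at hCS
  simp only [← hsq] at hCS
  have hid := congrArg norm (integral_mul_deriv_fracIntegral_eq hα hT hε hv hv' hw hw' hC)
  rw [Complex.norm_real, Real.norm_eq_abs] at hid
  refine (le_abs_self _).trans (hid.trans_le ?_)
  refine (MeasureTheory.norm_integral_le_integral_norm _).trans (hCS.trans ?_)
  refine (mul_le_mul (Real.sqrt_le_sqrt hVV) (Real.sqrt_le_sqrt hWW) (Real.sqrt_nonneg _)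
    (Real.sqrt_nonneg _)).trans_eq ?_
  have h0 : (0 : ℝ) ≤ 1 / Real.cos (α * π / 2) := by positivity
  rw [Real.sqrt_mul h0, Real.sqrt_mul h0, mul_mul_mul_comm, Real.mul_self_sqrt h0, mul_assoc]

lemma tendsto_damped_integral {T : ℝ} {f : ℝ → ℝ} (hf : IntervalIntegrable f volume 0 T)
    (hT : 0 ≤ T) :
    Tendsto (fun ε => ∫ t in (0 : ℝ)..T, Real.exp (-2 * ε * t) * f t) (𝓝[>] 0)
      (𝓝 (∫ t in (0 : ℝ)..T, f t)) := by
  refine intervalIntegral.tendsto_integral_filter_of_dominated_convergence (fun t => |f t|)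
    (Eventually.of_forall fun ε => ?_) ?_ hf.abs (Eventually.of_forall fun t _ => ?_)
  · exact (Continuous.aestronglyMeasurable (by fun_prop)).mul
      (intervalIntegrable_iff.1 hf).aestronglyMeasurable
  · filter_upwards [self_mem_nhdsWithin] with ε hε
    refine Eventually.of_forall fun t ht => ?_
    rw [uIoc_of_le hT] at ht
    rw [norm_mul, Real.norm_eq_abs, Real.norm_eq_abs, Real.abs_exp]
    refine mul_le_of_le_one_left (abs_nonneg _) (Real.exp_le_one_iff.2 ?_)
    nlinarith [mul_nonneg (le_of_lt (mem_Ioi.1 hε)) ht.1.le]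
  · have h : Continuous fun ε : ℝ => Real.exp (-2 * ε * t) * f t := by fun_prop
    simpa using (h.tendsto 0).mono_left nhdsWithin_le_nhds

lemma integral_mul_deriv_fracIntegral_le {α T C D : ℝ} (hα : -1 < α) (hα0 : α < 0)
    (hT : 0 ≤ T)
    {v v' w w' : ℝ → ℝ} (hv : ∀ t, HasDerivAt v (v' t) t) (hv' : Continuous v')
    (hD : ∀ t, |v' t| ≤ D)
    (hw : ∀ t, HasDerivAt w (w' t) t) (hw' : Continuous w') (hC : ∀ t, |w' t| ≤ C) :
    ∫ t in (0 : ℝ)..T, v t * deriv (fracIntegral α w) t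
      ≤ (1 / Real.cos (α * π / 2)) *
        √(∫ t in (0 : ℝ)..T, v t * deriv (fracIntegral α v) t) *
        √(∫ t in (0 : ℝ)..T, w t * deriv (fracIntegral α w) t) := by
  have hvc : Continuous v := continuous_iff_continuousAt.2 fun t => (hv t).continuousAt
  have hwc : Continuous w := continuous_iff_continuousAt.2 fun t => (hw t).continuousAt
  have hFv := (fracIntegral_regularity hα hT hv hD).2.2
  have hFw := (fracIntegral_regularity hα hT hw hC).2.2
  have hlim : ∀ {p q : ℝ → ℝ}, Continuous p → IntervalIntegrable q volume 0 T →
      Tendsto (fun ε => ∫ t in (0 : ℝ)..T, Real.exp (-2 * ε * t) * p t * q t) (𝓝[>] 0)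
        (𝓝 (∫ t in (0 : ℝ)..T, p t * q t)) := by
    intro p q hp hq
    simp only [mul_assoc (Real.exp _)]
    exact tendsto_damped_integral (hq.continuousOn_mul hp.continuousOn) hT
  refine le_of_tendsto_of_tendsto (hlim hvc hFw)
    (((hlim hvc hFv).sqrt.const_mul _).mul (hlim hwc hFw).sqrt) ?_
  filter_upwards [self_mem_nhdsWithin] with ε hε
  exact damped_integral_mul_deriv_fracIntegral_le hα hα0 hT hε hv hv' hD hw hw' hC

/-- A `C¹` function on `[0, T]` agrees there with a globally `C¹` function whose derivative is
bounded. -/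
lemma exists_contDiff_extension {T : ℝ} (hT : 0 ≤ T) {v v' : ℝ → ℝ}
    (hv : ∀ s ∈ Icc (0 : ℝ) T, HasDerivAt v (v' s) s) (hv' : ContinuousOn v' (Icc 0 T)) :
    ∃ (u u' : ℝ → ℝ) (C : ℝ), (∀ t, HasDerivAt u (u' t) t) ∧ Continuous u' ∧
      (∀ t, |u' t| ≤ C) ∧ EqOn v u (Icc 0 T) := by
  obtain ⟨C, hC⟩ := isCompact_Icc.exists_bound_of_continuousOn hv'
  have hc : Continuous (IccExtend hT ((Icc 0 T).domRestrict v')) := hv'.domRestrict.Icc_extend'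
  refine ⟨fun x => v 0 + ∫ s in (0 : ℝ)..x, IccExtend hT ((Icc 0 T).domRestrict v') s,
    IccExtend hT ((Icc 0 T).domRestrict v'), C, fun t => ?_, hc, fun t => ?_, fun t ht => ?_⟩
  · exact (hc.integral_hasStrictDerivAt 0 t).hasDerivAt.const_add _
  · exact hC _ (projIcc 0 T hT t).2
  · have hint : ∫ s in (0 : ℝ)..t, IccExtend hT ((Icc 0 T).domRestrict v') s
        = ∫ s in (0 : ℝ)..t, v' s := by
      refine intervalIntegral.integral_congr fun s hs => ?_
      rw [uIcc_of_le ht.1] at hs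
      exact IccExtend_of_mem hT _ ⟨hs.1, hs.2.trans ht.2⟩
    have hsub : uIcc 0 t ⊆ Icc 0 T := by
      rw [uIcc_of_le ht.1]
      exact Icc_subset_Icc_right ht.2
    simp only [hint]
    rw [intervalIntegral.integral_eq_sub_of_hasDerivAt (fun s hs => hv s (hsub hs))
      (hv'.mono hsub).intervalIntegrable]
    ring

lemma integral_mul_deriv_fracIntegral_congr {α T : ℝ} (hT : 0 ≤ T) {p q u w : ℝ → ℝ}
    (hp : EqOn p u (Icc 0 T)) (hq : EqOn q w (Icc 0 T)) :
    ∫ t in (0 : ℝ)..T, p t * deriv (fracIntegral α q) t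
      = ∫ t in (0 : ℝ)..T, u t * deriv (fracIntegral α w) t := by
  have hne : ∀ᵐ t : ℝ, t ≠ T := by simp [ae_iff]
  refine intervalIntegral.integral_congr_ae ?_
  filter_upwards [hne] with t hne ht
  rw [uIoc_of_le hT] at ht
  have hlt : t < T := lt_of_le_of_ne ht.2 hne
  have hF : fracIntegral α q =ᶠ[𝓝 t] fracIntegral α w := by
    filter_upwards [Ioo_mem_nhds ht.1 hlt] with τ hτ
    refine intervalIntegral.integral_congr fun s hs => ?_
    rw [uIcc_of_le hτ.1.le] at hs
    simp only [hq ⟨hs.1, hs.2.trans hτ.2.le⟩]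
  rw [hp ⟨ht.1.le, ht.2⟩, hF.deriv_eq]

/-- For `-1 < α < 0`, `T > 0`, `d_α = 1/cos(απ/2)` and all `v, w ∈ C¹([0,T])`,
`∫₀ᵀ v 𝓑_α w ≤ d_α (∫₀ᵀ v 𝓑_α v)^{1/2} (∫₀ᵀ w 𝓑_α w)^{1/2}`. -/
theorem stmt_9 (α T : ℝ) (hα₁ : -1 < α) (hα₂ : α < 0) (hT : 0 < T)
    (v v' w w' : ℝ → ℝ)
    (hv : ∀ s ∈ Set.Icc (0:ℝ) T, HasDerivAt v (v' s) s)
    (hv' : ContinuousOn v' (Set.Icc 0 T))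
    (hw : ∀ s ∈ Set.Icc (0:ℝ) T, HasDerivAt w (w' s) s)
    (hw' : ContinuousOn w' (Set.Icc 0 T)) :
    ∫ t in (0:ℝ)..T,
        v t * deriv (fun τ => ∫ s in (0:ℝ)..τ, ((τ - s) ^ α / Real.Gamma (α + 1)) * w s) t
      ≤ (1 / Real.cos (α * Real.pi / 2)) *
          Real.sqrt (∫ t in (0:ℝ)..T,
            v t * deriv (fun τ => ∫ s in (0:ℝ)..τ, ((τ - s) ^ α / Real.Gamma (α + 1)) * v s) t) *
          Real.sqrt (∫ t in (0:ℝ)..T,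
            w t * deriv (fun τ => ∫ s in (0:ℝ)..τ, ((τ - s) ^ α / Real.Gamma (α + 1)) * w s) t) := by
  obtain ⟨p, p', D, hp, hp', hD, hvp⟩ := exists_contDiff_extension hT.le hv hv'
  obtain ⟨q, q', C, hq, hq', hC, hwq⟩ := exists_contDiff_extension hT.le hw hw'
  have h := integral_mul_deriv_fracIntegral_le hα₁ hα₂ hT.le hp hp' hD hq hq' hC
  rwa [← integral_mul_deriv_fracIntegral_congr hT.le hvp hwq,
    ← integral_mul_deriv_fracIntegral_congr hT.le hvp hvp,
    ← integral_mul_deriv_fracIntegral_congr hT.le hwq hwq] at h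
end
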